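/- Sharp Sobolev inequality: for every continuously differentiable f : ℝ³ → ℂ with f ∈ L⁶(ℝ³) and ∇f ∈ L²(ℝ³), one has ‖f‖_{L⁶} ≤ C_GN ‖∇f‖_{L²}, where C_GN = ‖W‖_{L⁶} / ‖∇W‖_{L²}. -/

import Mathlib

open MeasureTheory Complex
open scoped BigOperators ENNReal

noncomputable section

abbrev E3 := EuclideanSpace ℝ (Fin 3)

/-- The Aubin–Talenti ground state `W(x) = (1 + |x|²/3)^(-1/2)`. -/
def W (x : E3) : ℝ := (1 + ‖x‖ ^ 2 / 3) ^ (-(1 : ℝ) / 2)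

/-- `W` viewed as a complex-valued function. -/
def Wc (x : E3) : ℂ := (W x : ℂ)

/-- Standard basis vectors of ℝ³. -/
def e3 (i : Fin 3) : E3 := EuclideanSpace.single i 1

/-- Partial derivative of a real-valued function. -/
def pdR (i : Fin 3) (f : E3 → ℝ) (x : E3) : ℝ := fderiv ℝ f x (e3 i)

/-- Partial derivative of a complex-valued function. -/
def pdC (i : Fin 3) (f : E3 → ℂ) (x : E3) : ℂ := fderiv ℝ f x (e3 i)

/-- Squared gradient `|∇f|²` of a real-valued function. -/
def gradSqR (f : E3 → ℝ) (x : E3) : ℝ := ∑ i, (pdR i f x) ^ 2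

/-- Squared gradient `|∇f|²` of a complex-valued function. -/
def gradSqC (f : E3 → ℂ) (x : E3) : ℝ := ∑ i, ‖pdC i f x‖ ^ 2

/-- Laplacian of a real-valued function. -/
def lapR (f : E3 → ℝ) (x : E3) : ℝ := ∑ i, pdR i (pdR i f) x

/-- Laplacian of a complex-valued function. -/
def lapC (f : E3 → ℂ) (x : E3) : ℂ := ∑ i, pdC i (pdC i f) x

/-- Quintic (energy-critical) energy `E^c`. -/
def Ecrit (f : E3 → ℂ) : ℝ := ∫ x : E3, ((1:ℝ)/2 * gradSqC f x - 1/6 * ‖f x‖ ^ 6)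

/-- Cubic–quintic energy `E`. -/
def Ecq (f : E3 → ℂ) : ℝ :=
  ∫ x : E3, ((1:ℝ)/2 * gradSqC f x - 1/6 * ‖f x‖ ^ 6 + 1/4 * ‖f x‖ ^ 4)

/-- Regular solutions of the cubic–quintic NLS on an interval `I ⊆ ℝ`. -/
def IsRegularSolution (I : Set ℝ) (u : ℝ → E3 → ℂ) : Prop :=
  ContDiffOn ℝ (⊤ : ℕ∞) (fun p : ℝ × E3 => u p.1 p.2) (I ×ˢ Set.univ) ∧
  (∀ t ∈ I, ∀ x : E3, Complex.I * deriv (fun s => u s x) t + lapC (u t) x =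
      (‖u t x‖ : ℂ) ^ 2 * u t x - (‖u t x‖ : ℂ) ^ 4 * u t x) ∧
  (∀ J : Set ℝ, IsCompact J → J ⊆ I → ∀ n k : ℕ, ∃ C : ℝ, ∀ t ∈ J, ∀ x : E3,
      (1 + ‖x‖) ^ n * ‖iteratedFDeriv ℝ k (u t) x‖ ≤ C)


/-- The sharp Sobolev constant `C_GN = ‖W‖_{L⁶} / ‖∇W‖_{L²}`. -/
def CGN : ℝ := (∫ x : E3, (W x) ^ 6) ^ ((1:ℝ)/6) / (∫ x : E3, gradSqR W x) ^ ((1:ℝ)/2)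

/-- The distribution function `t ↦ ∫_{-∞}^t K` of a density `K` on the line. -/
def partialMass (K : ℝ → ℝ) (t : ℝ) : ℝ := ∫ s in Set.Iic t, K s

section PartialMass

open Set Filter Topology

variable {K : ℝ → ℝ}

lemma partialMass_sub (hi : Integrable K) (a b : ℝ) :
    partialMass K b - partialMass K a = ∫ s in a..b, K s :=
  intervalIntegral.integral_Iic_sub_Iic hi.integrableOn hi.integrableOn

lemma hasDerivAt_partialMass (hi : Integrable K) (hc : Continuous K) (t : ℝ) :
    HasDerivAt (partialMass K) (K t) t := by
  have h := (intervalIntegral.integral_hasDerivAt_right (hi.intervalIntegrable (a := 0) (b := t))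
    (hc.stronglyMeasurableAtFilter _ _) hc.continuousAt).const_add (partialMass K 0)
  refine h.congr_of_eventuallyEq (Eventually.of_forall fun b => ?_)
  simp [← partialMass_sub hi 0 b]

lemma continuous_partialMass (hi : Integrable K) (hc : Continuous K) :
    Continuous (partialMass K) :=
  continuous_iff_continuousAt.2 fun t => (hasDerivAt_partialMass hi hc t).continuousAt

lemma strictMono_partialMass (hi : Integrable K) (hp : ∀ s, 0 < K s) :
    StrictMono (partialMass K) := by
  intro a b hab
  rw [← sub_pos, partialMass_sub hi]
  exact intervalIntegral.intervalIntegral_pos_of_pos hi.intervalIntegrable hp hab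

lemma tendsto_partialMass_atTop (hi : Integrable K) :
    Tendsto (partialMass K) atTop (𝓝 (∫ s, K s)) :=
  (aecover_Iic tendsto_id).integral_tendsto_of_countably_generated hi

lemma tendsto_partialMass_atBot :
    Tendsto (partialMass K) atBot (𝓝 0) := tendsto_integral_Iic_zero tendsto_id

lemma partialMass_pos (hi : Integrable K) (hp : ∀ s, 0 < K s) (t : ℝ) :
    0 < partialMass K t :=
  lt_of_le_of_lt (integral_nonneg fun s => (hp s).le)
    (strictMono_partialMass hi hp (sub_one_lt t))

lemma partialMass_lt (hi : Integrable K) (hp : ∀ s, 0 < K s) (t : ℝ) :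
    partialMass K t < ∫ s, K s :=
  lt_of_lt_of_le (strictMono_partialMass hi hp (lt_add_one t))
    (setIntegral_le_integral hi (Eventually.of_forall fun s => (hp s).le))

lemma exists_partialMass_eq (hi : Integrable K) (hc : Continuous K) {c : ℝ} (h0 : 0 < c)
    (h1 : c < ∫ s, K s) : ∃ t, partialMass K t = c := by
  obtain ⟨a, ha⟩ := (tendsto_partialMass_atBot.eventually_lt_const h0).exists
  obtain ⟨b, hb⟩ := ((tendsto_partialMass_atTop hi).eventually_const_lt h1).exists
  exact mem_range_of_exists_le_of_exists_ge (continuous_partialMass hi hc) ⟨a, ha.le⟩ ⟨b, hb.le⟩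

variable {P : Type*} [TopologicalSpace P] [FirstCountableTopology P] {J : P → ℝ → ℝ} {C : ℝ}

lemma integrable_of_cauchy_bound (hc : Continuous K) (hp : ∀ s, 0 < K s)
    (hb : ∀ s, K s ≤ C * (1 + s ^ 2)⁻¹) : Integrable K := by
  refine (integrable_inv_one_add_sq.const_mul C).mono' hc.aestronglyMeasurable ?_
  exact Eventually.of_forall fun s => by rw [Real.norm_of_nonneg (hp s).le]; exact hb s

lemma continuous_integral_of_cauchy_bound (hc : Continuous fun x : P × ℝ => J x.1 x.2)
    (hp : ∀ p s, 0 < J p s) (hb : ∀ p s, J p s ≤ C * (1 + s ^ 2)⁻¹) :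
    Continuous fun p => ∫ s, J p s := by
  refine continuous_of_dominated (bound := fun s => C * (1 + s ^ 2)⁻¹) (fun p => ?_) (fun p => ?_)
    (integrable_inv_one_add_sq.const_mul C) ?_
  · exact (hc.comp (by fun_prop : Continuous fun s : ℝ => (p, s))).aestronglyMeasurable
  · exact Eventually.of_forall fun s => by rw [Real.norm_of_nonneg (hp p s).le]; exact hb p s
  · exact Eventually.of_forall fun s => hc.comp (by fun_prop : Continuous fun p : P => (p, s))

lemma continuous_partialMass_of_cauchy_bound (hc : Continuous fun x : P × ℝ => J x.1 x.2)
    (hp : ∀ p s, 0 < J p s) (hb : ∀ p s, J p s ≤ C * (1 + s ^ 2)⁻¹) :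
    Continuous fun x : P × ℝ => partialMass (J x.1) x.2 := by
  have hc' : ∀ p, Continuous (J p) := fun p =>
    hc.comp (by fun_prop : Continuous fun s : ℝ => (p, s))
  have e : ∀ x : P × ℝ, partialMass (J x.1) x.2 = ∫ s, (Iic x.2).indicator (J x.1) s :=
    fun x => (integral_indicator measurableSet_Iic).symm
  simp_rw [e]
  refine continuous_iff_continuousAt.2 fun x => ?_
  refine continuousAt_of_dominated (bound := fun s => C * (1 + s ^ 2)⁻¹)
    (Eventually.of_forall fun y => ?_) (Eventually.of_forall fun y => ?_)
    (integrable_inv_one_add_sq.const_mul C) ?_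
  · exact (hc' y.1).aestronglyMeasurable.indicator measurableSet_Iic
  · refine Eventually.of_forall fun s => ?_
    refine (norm_indicator_le_norm_self _ _).trans ?_
    rw [Real.norm_of_nonneg (hp _ s).le]
    exact hb _ s
  · have hne : ∀ᵐ s : ℝ, s ≠ x.2 := by simp [ae_iff]
    filter_upwards [hne] with s hs
    rcases lt_or_gt_of_ne hs with h | h
    · have h1 : ∀ᶠ y : P × ℝ in 𝓝 x, (Iic y.2).indicator (J y.1) s = J y.1 s := by
        filter_upwards [continuous_snd.continuousAt.eventually_const_lt h] with y hy
        exact indicator_of_mem (mem_Iic.2 hy.le) _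
      refine ContinuousAt.congr ?_ (h1.mono fun y hy => hy.symm)
      exact (hc.comp (by fun_prop : Continuous fun y : P × ℝ => (y.1, s))).continuousAt
    · have h1 : ∀ᶠ y : P × ℝ in 𝓝 x, (Iic y.2).indicator (J y.1) s = 0 := by
        filter_upwards [continuous_snd.continuousAt.eventually_lt_const h] with y hy
        exact indicator_of_notMem (by simpa using hy) _
      exact ContinuousAt.congr continuousAt_const (h1.mono fun y hy => hy.symm)

/-- Monotone rearrangement of the densities `J p` onto the densities `L p`, depending continuously
on the parameter `p`. -/
theorem exists_monotone_transport {L : P → ℝ → ℝ} {C' : ℝ}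
    (hJ : Continuous fun x : P × ℝ => J x.1 x.2) (hJp : ∀ p s, 0 < J p s)
    (hJb : ∀ p s, J p s ≤ C * (1 + s ^ 2)⁻¹)
    (hL : Continuous fun x : P × ℝ => L x.1 x.2) (hLp : ∀ p s, 0 < L p s)
    (hLb : ∀ p s, L p s ≤ C' * (1 + s ^ 2)⁻¹) :
    ∃ T : P → ℝ → ℝ, (Continuous fun x : P × ℝ => T x.1 x.2) ∧ (∀ p, Function.Bijective (T p)) ∧
      ∀ p t, HasDerivAt (T p) (J p t / (∫ s, J p s) * ((∫ s, L p s) / L p (T p t))) t := by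
  have cJ : ∀ p, Continuous (J p) := fun p => hJ.comp (by fun_prop : Continuous fun s : ℝ => (p, s))
  have cL : ∀ p, Continuous (L p) := fun p => hL.comp (by fun_prop : Continuous fun s : ℝ => (p, s))
  have iJ := fun p => integrable_of_cauchy_bound (cJ p) (hJp p) (hJb p)
  have iL := fun p => integrable_of_cauchy_bound (cL p) (hLp p) (hLb p)
  have mJ : ∀ p, 0 < ∫ s, J p s := fun p =>
    (partialMass_pos (iJ p) (hJp p) 0).trans (partialMass_lt (iJ p) (hJp p) 0)
  have mL : ∀ p, 0 < ∫ s, L p s := fun p =>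
    (partialMass_pos (iL p) (hLp p) 0).trans (partialMass_lt (iL p) (hLp p) 0)
  have ex : ∀ p t, ∃ s, partialMass (L p) s = partialMass (J p) t / (∫ s, J p s) * ∫ s, L p s := by
    intro p t
    refine exists_partialMass_eq (iL p) (cL p) ?_ ?_
    · have := partialMass_pos (iJ p) (hJp p) t
      have := mJ p
      have := mL p
      positivity
    · have := (div_lt_one (mJ p)).2 (partialMass_lt (iJ p) (hJp p) t)
      exact mul_lt_of_lt_one_left (mL p) this
  choose T hT using ex
  have sJ := fun p => strictMono_partialMass (iJ p) (hJp p)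
  have sL := fun p => strictMono_partialMass (iL p) (hLp p)
  have contT : Continuous fun x : P × ℝ => T x.1 x.2 := by
    have c1 := continuous_partialMass_of_cauchy_bound hJ hJp hJb
    have c2 := continuous_partialMass_of_cauchy_bound hL hLp hLb
    have c3 := continuous_integral_of_cauchy_bound hJ hJp hJb
    have c4 := continuous_integral_of_cauchy_bound hL hLp hLb
    have c5 : Continuous fun x : P × ℝ =>
        partialMass (J x.1) x.2 / (∫ s, J x.1 s) * ∫ s, L x.1 s :=
      (c1.div (c3.comp continuous_fst) fun x => (mJ x.1).ne').mul (c4.comp continuous_fst)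
    have c6 : ∀ a : ℝ, Continuous fun x : P × ℝ => partialMass (L x.1) a := fun a =>
      c2.comp (by fun_prop : Continuous fun x : P × ℝ => (x.1, a))
    rw [continuous_iff_continuousAt]
    intro x
    refine tendsto_order.2 ⟨fun a ha => ?_, fun a ha => ?_⟩
    · have : partialMass (L x.1) a < partialMass (J x.1) x.2 / (∫ s, J x.1 s) * ∫ s, L x.1 s := by
        rw [← hT]; exact sL _ ha
      filter_upwards [(c6 a).continuousAt.eventually_lt c5.continuousAt this] with y hy
      rw [← hT] at hy
      exact (sL _).lt_iff_lt.1 hy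
    · have : partialMass (J x.1) x.2 / (∫ s, J x.1 s) * (∫ s, L x.1 s) < partialMass (L x.1) a := by
        rw [← hT]; exact sL _ ha
      filter_upwards [c5.continuousAt.eventually_lt (c6 a).continuousAt this] with y hy
      rw [← hT] at hy
      exact (sL _).lt_iff_lt.1 hy
  have inj : ∀ p, Function.Injective (T p) := by
    intro p a b hab
    have h := hT p a
    rw [hab, hT p b] at h
    have h2 := mul_right_cancel₀ (mL p).ne' h
    exact ((sJ p).injective ((div_left_inj' (mJ p).ne').1 h2)).symm
  refine ⟨T, contT, fun p => ⟨inj p, fun s => ?_⟩, fun p t => ?_⟩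
  · have h0 := partialMass_pos (iL p) (hLp p) s
    have h1 := (div_lt_one (mL p)).2 (partialMass_lt (iL p) (hLp p) s)
    obtain ⟨t, ht⟩ := exists_partialMass_eq (iJ p) (cJ p)
      (c := partialMass (L p) s / (∫ s, L p s) * ∫ s, J p s)
      (mul_pos (div_pos h0 (mL p)) (mJ p)) (mul_lt_of_lt_one_left (mJ p) h1)
    refine ⟨t, (sL p).injective ?_⟩
    rw [hT, ht, mul_div_cancel_right₀ _ (mJ p).ne', div_mul_cancel₀ _ (mL p).ne']
  · have dJ := hasDerivAt_iff_tendsto_slope.1 (hasDerivAt_partialMass (iJ p) (cJ p) t)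
    have dL := hasDerivAt_iff_tendsto_slope.1 (hasDerivAt_partialMass (iL p) (cL p) (T p t))
    have hTt : Tendsto (T p) (𝓝[≠] t) (𝓝[≠] (T p t)) := by
      refine tendsto_nhdsWithin_iff.2 ⟨?_, ?_⟩
      · have : Continuous (T p) := contT.comp (by fun_prop : Continuous fun s : ℝ => (p, s))
        exact this.continuousAt.mono_left nhdsWithin_le_nhds
      · filter_upwards [self_mem_nhdsWithin] with s hs using (inj p).ne hs
    rw [hasDerivAt_iff_tendsto_slope]
    have key := (((dJ.div_const (∫ s, J p s)).mul_const (∫ s, L p s)).div (dL.comp hTt)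
      (hLp p _).ne')
    rw [mul_div_assoc] at key
    refine key.congr' ?_
    filter_upwards [self_mem_nhdsWithin] with s hs
    have hs' : s - t ≠ 0 := sub_ne_zero.2 hs
    have hs2 : T p s - T p t ≠ 0 := sub_ne_zero.2 ((inj p).ne hs)
    have hs3 : partialMass (L p) (T p s) - partialMass (L p) (T p t) ≠ 0 :=
      sub_ne_zero.2 ((sL p).injective.ne ((inj p).ne hs))
    have e : (partialMass (J p) s - partialMass (J p) t) / (∫ s, J p s) * (∫ s, L p s) =
        partialMass (L p) (T p s) - partialMass (L p) (T p t) := by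
      rw [hT, hT]; ring
    simp only [slope_def_field, Pi.div_apply, Function.comp]
    rw [div_right_comm, div_mul_eq_mul_div, e]
    field_simp

end PartialMass

section Knothe

open Set Filter Topology

lemma lintegral_comp_mul_deriv_of_bijective {T D : ℝ → ℝ} (hT : Function.Bijective T)
    (hD : ∀ t, HasDerivAt T (D t) t) (hp : ∀ t, 0 < D t) (g : ℝ → ℝ≥0∞) :
    ∫⁻ t, ENNReal.ofReal (D t) * g (T t) = ∫⁻ s, g s := by
  have h := lintegral_image_eq_lintegral_abs_deriv_mul MeasurableSet.univ
    (fun t _ => (hD t).hasDerivWithinAt) hT.1.injOn g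
  rw [image_univ, hT.2.range_eq, setLIntegral_univ, setLIntegral_univ] at h
  rw [h]
  simp_rw [abs_of_pos (hp _)]

lemma integral_le_pi_mul_of_cauchy_bound {K : ℝ → ℝ} {C : ℝ} (hc : Continuous K)
    (hp : ∀ s, 0 < K s) (hb : ∀ s, K s ≤ C * (1 + s ^ 2)⁻¹) : ∫ s, K s ≤ C * Real.pi := by
  rw [← integral_univ_inv_one_add_sq, ← integral_const_mul]
  exact integral_mono (integrable_of_cauchy_bound hc hp hb)
    (integrable_inv_one_add_sq.const_mul C) hb

lemma integral_pos_of_cauchy_bound {K : ℝ → ℝ} {C : ℝ} (hc : Continuous K)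
    (hp : ∀ s, 0 < K s) (hb : ∀ s, K s ≤ C * (1 + s ^ 2)⁻¹) : 0 < ∫ s, K s :=
  (partialMass_pos (integrable_of_cauchy_bound hc hp hb) hp 0).trans
    (partialMass_lt (integrable_of_cauchy_bound hc hp hb) hp 0)

lemma inv_one_add_sq_le_one (s : ℝ) : (1 + s ^ 2)⁻¹ ≤ 1 :=
  inv_le_one_of_one_le₀ (by nlinarith [sq_nonneg s])

lemma mul_inv_one_add_sq_le {C s : ℝ} (hC : 0 ≤ C) : C * (1 + s ^ 2)⁻¹ ≤ C :=
  mul_le_of_le_one_right hC (inv_one_add_sq_le_one s)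

/-- The marginals of a positive density on `ℝ³` dominated by a product of Cauchy densities. -/
lemma marginals_of_cauchy_bound {F : ℝ → ℝ → ℝ → ℝ} {C : ℝ} (hC : 0 ≤ C)
    (hF : Continuous fun x : (ℝ × ℝ) × ℝ => F x.1.1 x.1.2 x.2) (hFp : ∀ x y z, 0 < F x y z)
    (hFb : ∀ x y z, F x y z ≤ C * (1 + x ^ 2)⁻¹ * (1 + y ^ 2)⁻¹ * (1 + z ^ 2)⁻¹) :
    (∀ p : ℝ × ℝ, ∀ z, F p.1 p.2 z ≤ C * (1 + z ^ 2)⁻¹) ∧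
    (Continuous fun p : ℝ × ℝ => ∫ z, F p.1 p.2 z) ∧ (∀ x y, 0 < ∫ z, F x y z) ∧
    (∀ x y, ∫ z, F x y z ≤ C * Real.pi * (1 + y ^ 2)⁻¹) ∧
    (Continuous fun x => ∫ y, ∫ z, F x y z) ∧ (∀ x, 0 < ∫ y, ∫ z, F x y z) ∧
    (∀ x, ∫ y, ∫ z, F x y z ≤ C * Real.pi * Real.pi * (1 + x ^ 2)⁻¹) := by
  have hpi := Real.pi_pos.le
  have inv0 : ∀ s : ℝ, 0 ≤ (1 + s ^ 2)⁻¹ := fun s => by positivity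
  have c3 : ∀ x y, Continuous (F x y) := fun x y =>
    hF.comp (by fun_prop : Continuous fun z : ℝ => ((x, y), z))
  have b3 : ∀ p : ℝ × ℝ, ∀ z, F p.1 p.2 z ≤ C * (1 + z ^ 2)⁻¹ := fun p z =>
    (hFb _ _ _).trans (mul_le_mul_of_nonneg_right ((mul_inv_one_add_sq_le
      (mul_nonneg hC (inv0 _))).trans (mul_inv_one_add_sq_le hC)) (inv0 _))
  have hc2 : Continuous fun p : ℝ × ℝ => ∫ z, F p.1 p.2 z :=
    continuous_integral_of_cauchy_bound (J := fun p : ℝ × ℝ => F p.1 p.2) hF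
      (fun p z => hFp _ _ _) b3
  have p2 : ∀ x y, 0 < ∫ z, F x y z := fun x y =>
    integral_pos_of_cauchy_bound (c3 x y) (hFp x y) (b3 (x, y))
  have b2' : ∀ x y, ∫ z, F x y z ≤ C * Real.pi * (1 + x ^ 2)⁻¹ * (1 + y ^ 2)⁻¹ := fun x y => by
    refine (integral_le_pi_mul_of_cauchy_bound (c3 x y) (hFp x y) (hFb x y)).trans_eq ?_
    ring
  have b2 : ∀ x y, ∫ z, F x y z ≤ C * Real.pi * (1 + y ^ 2)⁻¹ := fun x y =>
    (b2' x y).trans (mul_le_mul_of_nonneg_right (mul_inv_one_add_sq_le (mul_nonneg hC hpi))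
      (inv0 _))
  have c2 : ∀ x, Continuous fun y => ∫ z, F x y z := fun x =>
    hc2.comp (by fun_prop : Continuous fun y : ℝ => (x, y))
  refine ⟨b3, hc2, p2, b2, ?_, fun x => ?_, fun x => ?_⟩
  · exact continuous_integral_of_cauchy_bound hc2 p2 b2
  · exact integral_pos_of_cauchy_bound (c2 x) (p2 x) (b2 x)
  · refine (integral_le_pi_mul_of_cauchy_bound (c2 x) (p2 x) (b2' x)).trans_eq ?_
    ring

/-- The **Knothe rearrangement**: a triangular monotone map transporting the density `F` to a
multiple of the density `G`. -/
theorem exists_knothe {F G : ℝ → ℝ → ℝ → ℝ} {C C' : ℝ} (hC : 0 ≤ C) (hC' : 0 ≤ C')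
    (hF : Continuous fun x : (ℝ × ℝ) × ℝ => F x.1.1 x.1.2 x.2) (hFp : ∀ x y z, 0 < F x y z)
    (hFb : ∀ x y z, F x y z ≤ C * (1 + x ^ 2)⁻¹ * (1 + y ^ 2)⁻¹ * (1 + z ^ 2)⁻¹)
    (hG : Continuous fun x : (ℝ × ℝ) × ℝ => G x.1.1 x.1.2 x.2) (hGp : ∀ x y z, 0 < G x y z)
    (hGb : ∀ x y z, G x y z ≤ C' * (1 + x ^ 2)⁻¹ * (1 + y ^ 2)⁻¹ * (1 + z ^ 2)⁻¹) :
    ∃ (T₁ D₁ : ℝ → ℝ) (T₂ D₂ : ℝ → ℝ → ℝ) (T₃ D₃ : ℝ → ℝ → ℝ → ℝ) (r : ℝ), 0 < r ∧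
      Continuous T₁ ∧ Continuous D₁ ∧
      (Continuous fun x : ℝ × ℝ => T₂ x.1 x.2) ∧ (Continuous fun x : ℝ × ℝ => D₂ x.1 x.2) ∧
      (Continuous fun x : (ℝ × ℝ) × ℝ => T₃ x.1.1 x.1.2 x.2) ∧
      (Continuous fun x : (ℝ × ℝ) × ℝ => D₃ x.1.1 x.1.2 x.2) ∧
      (∀ x, 0 < D₁ x) ∧ (∀ x y, 0 < D₂ x y) ∧ (∀ x y z, 0 < D₃ x y z) ∧
      (∀ x, HasDerivAt T₁ (D₁ x) x) ∧ (∀ x y, HasDerivAt (T₂ x) (D₂ x y) y) ∧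
      (∀ x y z, HasDerivAt (T₃ x y) (D₃ x y z) z) ∧
      (∀ x y z, D₁ x * D₂ x y * D₃ x y z * (r * G (T₁ x) (T₂ x y) (T₃ x y z)) = F x y z) ∧
      ∀ g : ℝ → ℝ → ℝ → ℝ≥0∞, ∫⁻ x, ∫⁻ y, ∫⁻ z, ENNReal.ofReal (D₁ x * D₂ x y * D₃ x y z) *
        g (T₁ x) (T₂ x y) (T₃ x y z) = ∫⁻ x, ∫⁻ y, ∫⁻ z, g x y z := by
  obtain ⟨F3b, F2c, F2p, F2b, F1c, F1p, F1b⟩ := marginals_of_cauchy_bound hC hF hFp hFb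
  obtain ⟨G3b, G2c, G2p, G2b, G1c, G1p, G1b⟩ := marginals_of_cauchy_bound hC' hG hGp hGb
  set F2 : ℝ → ℝ → ℝ := fun x y => ∫ z, F x y z with hF2
  set G2 : ℝ → ℝ → ℝ := fun x y => ∫ z, G x y z with hG2
  set F1 : ℝ → ℝ := fun x => ∫ y, ∫ z, F x y z with hF1
  set G1 : ℝ → ℝ := fun x => ∫ y, ∫ z, G x y z with hG1
  have F0p := integral_pos_of_cauchy_bound F1c F1p F1b
  have G0p := integral_pos_of_cauchy_bound G1c G1p G1b
  obtain ⟨T₁, T₁c, T₁b, T₁d⟩ := exists_monotone_transport (P := Unit) (J := fun _ => F1)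
    (L := fun _ => G1) (F1c.comp continuous_snd) (fun _ => F1p) (fun _ => F1b)
    (G1c.comp continuous_snd) (fun _ => G1p) (fun _ => G1b)
  replace T₁c : Continuous (T₁ ()) := T₁c.comp (by fun_prop : Continuous fun x : ℝ => ((), x))
  replace T₁b := T₁b ()
  replace T₁d := T₁d ()
  generalize T₁ () = T₁ at T₁c T₁b T₁d
  obtain ⟨T₂, T₂c, T₂b, T₂d⟩ := exists_monotone_transport (P := ℝ) (J := F2)
    (L := fun x => G2 (T₁ x)) F2c F2p F2b
    (G2c.comp (by fun_prop : Continuous fun x : ℝ × ℝ => (T₁ x.1, x.2)))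
    (fun x => G2p (T₁ x)) (fun x => G2b (T₁ x))
  obtain ⟨T₃, T₃c, T₃b, T₃d⟩ := exists_monotone_transport (P := ℝ × ℝ) (J := fun p => F p.1 p.2)
    (L := fun p => G (T₁ p.1) (T₂ p.1 p.2)) hF (fun p => hFp _ _) F3b
    (hG.comp (by fun_prop : Continuous fun x : (ℝ × ℝ) × ℝ =>
      ((T₁ x.1.1, T₂ x.1.1 x.1.2), x.2)))
    (fun p => hGp _ _) (fun p => G3b (T₁ p.1, T₂ p.1 p.2))
  have cF1 : Continuous fun x : ℝ × ℝ => F1 x.1 := F1c.comp continuous_fst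
  have cF2 : Continuous fun x : (ℝ × ℝ) × ℝ => F2 x.1.1 x.1.2 := F2c.comp continuous_fst
  have cG1 : Continuous fun x : ℝ × ℝ => G1 (T₁ x.1) := G1c.comp (T₁c.comp continuous_fst)
  have cG2 : Continuous fun x : ℝ × ℝ => G2 (T₁ x.1) (T₂ x.1 x.2) :=
    G2c.comp (by fun_prop : Continuous fun x : ℝ × ℝ => (T₁ x.1, T₂ x.1 x.2))
  have cG3 : Continuous fun x : (ℝ × ℝ) × ℝ => G (T₁ x.1.1) (T₂ x.1.1 x.1.2) (T₃ x.1 x.2) :=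
    hG.comp (by fun_prop : Continuous fun x : (ℝ × ℝ) × ℝ =>
      ((T₁ x.1.1, T₂ x.1.1 x.1.2), T₃ x.1 x.2))
  set D₁ : ℝ → ℝ := fun x => F1 x / (∫ x, F1 x) * ((∫ x, G1 x) / G1 (T₁ x)) with hD₁
  set D₂ : ℝ → ℝ → ℝ := fun x y => F2 x y / F1 x * (G1 (T₁ x) / G2 (T₁ x) (T₂ x y)) with hD₂
  set D₃ : ℝ → ℝ → ℝ → ℝ := fun x y z =>
    F x y z / F2 x y * (G2 (T₁ x) (T₂ x y) / G (T₁ x) (T₂ x y) (T₃ (x, y) z)) with hD₃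
  have D₁p : ∀ x, 0 < D₁ x := fun x =>
    mul_pos (div_pos (F1p _) F0p) (div_pos G0p (G1p _))
  have D₂p : ∀ x y, 0 < D₂ x y := fun x y =>
    mul_pos (div_pos (F2p _ _) (F1p _)) (div_pos (G1p _) (G2p _ _))
  have D₃p : ∀ x y z, 0 < D₃ x y z := fun x y z =>
    mul_pos (div_pos (hFp _ _ _) (F2p _ _)) (div_pos (G2p _ _) (hGp _ _ _))
  refine ⟨T₁, D₁, T₂, D₂, fun x y => T₃ (x, y), D₃, (∫ x, F1 x) / ∫ x, G1 x, div_pos F0p G0p,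
    T₁c, ?_, T₂c, ?_, T₃c, ?_, D₁p, D₂p, D₃p, T₁d, T₂d, fun x y => T₃d (x, y), ?_, ?_⟩
  · exact (F1c.div_const _).mul (continuous_const.div (G1c.comp T₁c) fun x => (G1p _).ne')
  · exact (F2c.div cF1 fun x => (F1p _).ne').mul (cG1.div cG2 fun x => (G2p _ _).ne')
  · exact (hF.div cF2 fun x => (F2p _ _).ne').mul
      ((cG2.comp continuous_fst).div cG3 fun x => (hGp _ _ _).ne')
  · intro x y z
    have h1 : F1 x ≠ 0 := (F1p x).ne'
    have h2 : F2 x y ≠ 0 := (F2p x y).ne'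
    have h3 : G1 (T₁ x) ≠ 0 := (G1p (T₁ x)).ne'
    have h4 : G2 (T₁ x) (T₂ x y) ≠ 0 := (G2p (T₁ x) (T₂ x y)).ne'
    have h5 := (hGp (T₁ x) (T₂ x y) (T₃ (x, y) z)).ne'
    have h6 := F0p.ne'
    have h7 := G0p.ne'
    simp only [hD₁, hD₂, hD₃]
    field_simp
  · intro g
    have s3 : ∀ x y, ∫⁻ z, ENNReal.ofReal (D₁ x * D₂ x y * D₃ x y z) *
        g (T₁ x) (T₂ x y) (T₃ (x, y) z) =
        ENNReal.ofReal (D₁ x) * (ENNReal.ofReal (D₂ x y) * ∫⁻ z, g (T₁ x) (T₂ x y) z) := by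
      intro x y
      have h : ∫⁻ z, ENNReal.ofReal (D₃ x y z) * g (T₁ x) (T₂ x y) (T₃ (x, y) z) =
          ∫⁻ z, g (T₁ x) (T₂ x y) z :=
        lintegral_comp_mul_deriv_of_bijective (T₃b (x, y)) (T₃d (x, y)) (D₃p x y) _
      have e : ∀ z, ENNReal.ofReal (D₁ x * D₂ x y * D₃ x y z) = ENNReal.ofReal (D₁ x) *
          (ENNReal.ofReal (D₂ x y) * ENNReal.ofReal (D₃ x y z)) := fun z => by
        rw [ENNReal.ofReal_mul (mul_pos (D₁p x) (D₂p x y)).le, ENNReal.ofReal_mul (D₁p x).le,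
          mul_assoc]
      simp_rw [e, mul_assoc]
      rw [lintegral_const_mul' _ _ ENNReal.ofReal_ne_top,
        lintegral_const_mul' _ _ ENNReal.ofReal_ne_top, h]
    simp_rw [s3]
    have s2 : ∀ x, ∫⁻ y, ENNReal.ofReal (D₁ x) *
        (ENNReal.ofReal (D₂ x y) * ∫⁻ z, g (T₁ x) (T₂ x y) z) =
        ENNReal.ofReal (D₁ x) * ∫⁻ y, ∫⁻ z, g (T₁ x) y z := by
      intro x
      rw [lintegral_const_mul' _ _ ENNReal.ofReal_ne_top]
      congr 1
      exact lintegral_comp_mul_deriv_of_bijective (T₂b x) (T₂d x) (D₂p x)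
        fun y => ∫⁻ z, g (T₁ x) y z
    simp_rw [s2]
    exact lintegral_comp_mul_deriv_of_bijective T₁b T₁d D₁p fun x => ∫⁻ y, ∫⁻ z, g x y z

end Knothe

section KnotheE3

open Set Filter Topology

lemma measurePreserving_E3_coords :
    MeasurePreserving (fun x : E3 => (x 0, x 1, x 2)) volume (volume : Measure (ℝ × ℝ × ℝ)) := by
  have h1 := PiLp.volume_preserving_ofLp (Fin 3)
  have h2 := volume_preserving_piFinSuccAbove (fun _ : Fin 3 => ℝ) 0
  have h3 := volume_preserving_finTwoArrow ℝ
  exact ((MeasurePreserving.id (volume : Measure ℝ)).prod h3).comp (h2.comp h1)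

lemma lintegral_E3 {g : E3 → ℝ≥0∞} (hg : Measurable g) :
    ∫⁻ x, g x = ∫⁻ a : ℝ, ∫⁻ b : ℝ, ∫⁻ c : ℝ, g !₂[a, b, c] := by
  have hm : Measurable fun p : ℝ × ℝ × ℝ => g !₂[p.1, p.2.1, p.2.2] := by
    refine hg.comp (Continuous.measurable ?_)
    refine (PiLp.continuous_toLp 2 _).comp (continuous_pi fun i => ?_)
    fin_cases i <;> simp <;> fun_prop
  have h := measurePreserving_E3_coords.lintegral_comp hm
  have e : ∀ x : E3, !₂[x 0, x 1, x 2] = x := fun x => by ext i; fin_cases i <;> rfl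
  simp only [e] at h
  rw [h, Measure.volume_eq_prod, lintegral_prod _ hm.aemeasurable]
  refine lintegral_congr fun a => ?_
  have hm' : Measurable fun q : ℝ × ℝ => g !₂[a, q.1, q.2] := hm.comp measurable_prodMk_left
  exact lintegral_prod _ hm'.aemeasurable

/-- The Knothe rearrangement on Euclidean space. -/
theorem exists_knothe_E3 {F G : E3 → ℝ} {C C' : ℝ} (hC : 0 ≤ C) (hC' : 0 ≤ C')
    (hF : Continuous F) (hFp : ∀ x, 0 < F x)
    (hFb : ∀ x, F x ≤ C * (1 + x 0 ^ 2)⁻¹ * (1 + x 1 ^ 2)⁻¹ * (1 + x 2 ^ 2)⁻¹)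
    (hG : Continuous G) (hGp : ∀ x, 0 < G x)
    (hGb : ∀ x, G x ≤ C' * (1 + x 0 ^ 2)⁻¹ * (1 + x 1 ^ 2)⁻¹ * (1 + x 2 ^ 2)⁻¹) :
    ∃ (T : E3 → E3) (D : Fin 3 → E3 → ℝ) (r : ℝ), 0 < r ∧ Continuous T ∧ (∀ i, Continuous (D i)) ∧
      (∀ i x, 0 < D i x) ∧ (∀ i x, HasLineDerivAt ℝ (fun y => T y i) (D i x) x (e3 i)) ∧
      (∀ x, D 0 x * D 1 x * D 2 x * (r * G (T x)) = F x) ∧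
      ∀ g : E3 → ℝ≥0∞, Measurable g →
        ∫⁻ x, ENNReal.ofReal (D 0 x * D 1 x * D 2 x) * g (T x) = ∫⁻ x, g x := by
  have cE : Continuous fun x : (ℝ × ℝ) × ℝ => (!₂[x.1.1, x.1.2, x.2] : E3) := by
    refine (PiLp.continuous_toLp 2 _).comp (continuous_pi fun i => ?_)
    fin_cases i <;> simp <;> fun_prop
  have c0 : ∀ i, Continuous fun x : E3 => x i := fun i => by fun_prop
  obtain ⟨T₁, D₁, T₂, D₂, T₃, D₃, r, hr, T₁c, D₁c, T₂c, D₂c, T₃c, D₃c, D₁p, D₂p, D₃p, T₁d, T₂d,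
    T₃d, hD, hg⟩ := exists_knothe (F := fun x y z => F !₂[x, y, z])
      (G := fun x y z => G !₂[x, y, z])
    hC hC' (hF.comp cE) (fun x y z => hFp _) (fun x y z => hFb !₂[x, y, z]) (hG.comp cE)
    (fun x y z => hGp _) (fun x y z => hGb !₂[x, y, z])
  have cT1 : Continuous fun x : E3 => T₁ (x 0) := T₁c.comp (c0 0)
  have cD1 : Continuous fun x : E3 => D₁ (x 0) := D₁c.comp (c0 0)
  have cT2 : Continuous fun x : E3 => T₂ (x 0) (x 1) := T₂c.comp ((c0 0).prodMk (c0 1))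
  have cD2 : Continuous fun x : E3 => D₂ (x 0) (x 1) := D₂c.comp ((c0 0).prodMk (c0 1))
  have cT3 : Continuous fun x : E3 => T₃ (x 0) (x 1) (x 2) :=
    T₃c.comp (((c0 0).prodMk (c0 1)).prodMk (c0 2))
  have cD3 : Continuous fun x : E3 => D₃ (x 0) (x 1) (x 2) :=
    D₃c.comp (((c0 0).prodMk (c0 1)).prodMk (c0 2))
  have e : ∀ x : E3, !₂[x 0, x 1, x 2] = x := fun x => by ext i; fin_cases i <;> rfl
  have cT : Continuous fun x : E3 =>
      (!₂[T₁ (x 0), T₂ (x 0) (x 1), T₃ (x 0) (x 1) (x 2)] : E3) := by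
    refine (PiLp.continuous_toLp 2 _).comp (continuous_pi fun i => ?_)
    fin_cases i
    exacts [cT1, cT2, cT3]
  have shift : ∀ {f : ℝ → ℝ} {f' a : ℝ}, HasDerivAt f f' a →
      HasDerivAt (fun t => f (a + t)) f' 0 := by
    intro f f' a h
    exact HasDerivAt.comp_const_add a 0 (by simpa using h)
  refine ⟨fun x => !₂[T₁ (x 0), T₂ (x 0) (x 1), T₃ (x 0) (x 1) (x 2)],
    ![fun x => D₁ (x 0), fun x => D₂ (x 0) (x 1), fun x => D₃ (x 0) (x 1) (x 2)], r, hr, cT,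
    ?_, ?_, ?_, ?_, ?_⟩
  · intro i
    fin_cases i
    exacts [cD1, cD2, cD3]
  · intro i x
    fin_cases i
    exacts [D₁p _, D₂p _ _, D₃p _ _ _]
  · intro i x
    unfold HasLineDerivAt
    fin_cases i
    · simpa [e3] using shift (T₁d (x 0))
    · simpa [e3] using shift (T₂d (x 0) (x 1))
    · simpa [e3] using shift (T₃d (x 0) (x 1) (x 2))
  · intro x
    have := hD (x 0) (x 1) (x 2)
    rw [e] at this
    exact this
  · intro g hgm
    rw [lintegral_E3 hgm, ← hg fun x y z => g !₂[x, y, z]]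
    rw [lintegral_E3]
    · simp
    · refine Measurable.mul ?_ (hgm.comp cT.measurable)
      exact ((cD1.mul cD2).mul cD3).measurable.ennreal_ofReal

end KnotheE3

section GroundState

open Set Filter Topology

/-- The polynomial `1 + |x|²/3 = W(x)⁻²`. -/
def talentiBase (x : E3) : ℝ := 1 + ‖x‖ ^ 2 / 3

lemma one_le_talentiBase (x : E3) : 1 ≤ talentiBase x := by
  unfold talentiBase; have := sq_nonneg ‖x‖; linarith

lemma talentiBase_pos (x : E3) : 0 < talentiBase x := zero_lt_one.trans_le (one_le_talentiBase x)

lemma continuous_talentiBase : Continuous talentiBase := by unfold talentiBase; fun_prop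

lemma continuous_inv_talentiBase_pow (n : ℕ) : Continuous fun x => (talentiBase x ^ n)⁻¹ :=
  (continuous_talentiBase.pow n).inv₀ fun x => (pow_pos (talentiBase_pos x) n).ne'

lemma E3_norm_sq (x : E3) : ‖x‖ ^ 2 = x 0 ^ 2 + x 1 ^ 2 + x 2 ^ 2 := by
  simp [EuclideanSpace.norm_sq_eq, Fin.sum_univ_three]

lemma W_pow_six (x : E3) : W x ^ 6 = (talentiBase x ^ 3)⁻¹ := by
  have h : W x = talentiBase x ^ (-(1 : ℝ) / 2) := rfl
  rw [h, ← Real.rpow_natCast, ← Real.rpow_mul (talentiBase_pos x).le, ← Real.rpow_natCast,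
    ← Real.rpow_neg (talentiBase_pos x).le]
  norm_num

lemma pdR_W (i : Fin 3) (x : E3) : pdR i W x = -(x i / 3) * talentiBase x ^ (-(3 : ℝ) / 2) := by
  have h1 : HasFDerivAt talentiBase ((3 : ℝ)⁻¹ • (2 • innerSL ℝ x)) x := by
    have := ((hasStrictFDerivAt_norm_sq x).hasFDerivAt.const_mul (3 : ℝ)⁻¹).const_add 1
    refine this.congr_of_eventuallyEq (Eventually.of_forall fun y => ?_)
    unfold talentiBase
    ring
  have h2 : HasFDerivAt W _ x :=
    h1.rpow_const (p := -(1 : ℝ) / 2) (Or.inl (talentiBase_pos x).ne')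
  have e : (-(1 : ℝ) / 2 - 1) = -(3 : ℝ) / 2 := by norm_num
  rw [pdR, h2.fderiv, e]
  have hi : inner ℝ x (e3 i) = x i := by simp [e3, EuclideanSpace.inner_single_right]
  simp [hi]
  ring

lemma gradSqR_W (x : E3) : gradSqR W x = ‖x‖ ^ 2 * (talentiBase x ^ 3)⁻¹ / 9 := by
  have h : (talentiBase x ^ (-(3 : ℝ) / 2)) ^ 2 = (talentiBase x ^ 3)⁻¹ := by
    rw [← Real.rpow_natCast, ← Real.rpow_mul (talentiBase_pos x).le, ← Real.rpow_natCast,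
      ← Real.rpow_neg (talentiBase_pos x).le]
    norm_num
  simp only [gradSqR, pdR_W, mul_pow, h, Fin.sum_univ_three, E3_norm_sq]
  ring

lemma inv_talentiBase_cube_le (x : E3) : (talentiBase x ^ 3)⁻¹ ≤
    27 * (1 + x 0 ^ 2)⁻¹ * (1 + x 1 ^ 2)⁻¹ * (1 + x 2 ^ 2)⁻¹ := by
  have h : ∀ i, (1 + x i ^ 2) / 3 ≤ talentiBase x := by
    intro i
    have h0 := sq_nonneg (x 0)
    have h1 := sq_nonneg (x 1)
    have h2 := sq_nonneg (x 2)
    unfold talentiBase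
    rw [E3_norm_sq]
    fin_cases i <;> simp <;> linarith
  have p : ∀ i, 0 < 1 + x i ^ 2 := fun i => by positivity
  have hprod : (1 + x 0 ^ 2) / 3 * ((1 + x 1 ^ 2) / 3) * ((1 + x 2 ^ 2) / 3) ≤
      talentiBase x ^ 3 := by
    have hp := (talentiBase_pos x).le
    calc _ ≤ talentiBase x * talentiBase x * talentiBase x :=
          mul_le_mul (mul_le_mul (h 0) (h 1) (by have := p 1; positivity) hp) (h 2)
            (by have := p 2; positivity) (by positivity)
      _ = _ := by ring
  refine (inv_anti₀ ?_ hprod).trans_eq ?_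
  · have := p 0
    have := p 1
    have := p 2
    positivity
  · have := (p 0).ne'
    have := (p 1).ne'
    have := (p 2).ne'
    field_simp
    norm_num

lemma integrable_inv_talentiBase_sq : Integrable fun x => (talentiBase x ^ 2)⁻¹ := by
  have h := (integrable_rpow_neg_one_add_norm_sq (E := E3) (μ := volume) (r := 4)
    (by simp; norm_num)).const_mul 9
  refine h.mono' (continuous_inv_talentiBase_pow 2).aestronglyMeasurable
    (Eventually.of_forall fun x => ?_)
  have hp := talentiBase_pos x
  have h0 : 0 < 1 + ‖x‖ ^ 2 := by positivity
  have e : (1 + ‖x‖ ^ 2) ^ (-(4 : ℝ) / 2) = ((1 + ‖x‖ ^ 2) ^ 2)⁻¹ := by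
    rw [← Real.rpow_natCast (1 + ‖x‖ ^ 2) 2, ← Real.rpow_neg h0.le]
    norm_num
  rw [Real.norm_of_nonneg (by positivity), e, ← div_eq_mul_inv, le_div_iff₀ (by positivity),
    inv_mul_le_iff₀ (by positivity)]
  unfold talentiBase
  nlinarith [sq_nonneg ‖x‖]

lemma integrable_inv_talentiBase_cube : Integrable fun x => (talentiBase x ^ 3)⁻¹ := by
  refine integrable_inv_talentiBase_sq.mono'
    (continuous_inv_talentiBase_pow 3).aestronglyMeasurable (Eventually.of_forall fun x => ?_)
  have hp := talentiBase_pos x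
  rw [Real.norm_of_nonneg (by positivity)]
  exact inv_anti₀ (by positivity) (pow_le_pow_right₀ (one_le_talentiBase x) (by norm_num))

lemma integrable_norm_sq_mul_inv_talentiBase_cube :
    Integrable fun x : E3 => ‖x‖ ^ 2 * (talentiBase x ^ 3)⁻¹ := by
  refine (integrable_inv_talentiBase_sq.const_mul 3).mono'
    ((continuous_norm.pow 2).mul (continuous_inv_talentiBase_pow 3)).aestronglyMeasurable
    (Eventually.of_forall fun x => ?_)
  have hp := talentiBase_pos x
  have h : ‖x‖ ^ 2 ≤ 3 * talentiBase x := by unfold talentiBase; linarith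
  rw [Real.norm_of_nonneg (by positivity)]
  calc ‖x‖ ^ 2 * (talentiBase x ^ 3)⁻¹ ≤ 3 * talentiBase x * (talentiBase x ^ 3)⁻¹ := by gcongr
    _ = _ := by field_simp

/-- The virial identity `∫ W⁴ = (4/9) ∫ |x|² W⁶`. -/
lemma integral_inv_talentiBase_sq : ∫ x, (talentiBase x ^ 2)⁻¹ =
    4 / 9 * ∫ x : E3, ‖x‖ ^ 2 * (talentiBase x ^ 3)⁻¹ := by
  rw [← integral_const_mul, ← sub_eq_zero, ← integral_sub integrable_inv_talentiBase_sq
    (integrable_norm_sq_mul_inv_talentiBase_cube.const_mul _)]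
  set h : ℝ → ℝ := fun r =>
    ((1 + r ^ 2 / 3) ^ 2)⁻¹ - 4 / 9 * (r ^ 2 * ((1 + r ^ 2 / 3) ^ 3)⁻¹) with hh
  have hint : Integrable fun x : E3 => h ‖x‖ := integrable_inv_talentiBase_sq.sub
    (integrable_norm_sq_mul_inv_talentiBase_cube.const_mul _)
  have hint' := (integrable_fun_norm_addHaar volume).1 hint
  have pos : ∀ r : ℝ, 0 < 1 + r ^ 2 / 3 := fun r => by positivity
  have key : ∫ y in Ioi (0 : ℝ), y ^ (Module.finrank ℝ E3 - 1) • h y =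
      0 - (0 : ℝ) ^ 3 / 3 * ((1 + (0 : ℝ) ^ 2 / 3) ^ 2)⁻¹ := by
    refine integral_Ioi_of_hasDerivAt_of_tendsto'
      (f := fun r : ℝ => r ^ 3 / 3 * ((1 + r ^ 2 / 3) ^ 2)⁻¹) (fun r _ => ?_) hint' ?_
    · have d := ((hasDerivAt_pow 3 r).div_const 3).mul
        (((((hasDerivAt_pow 2 r).div_const 3).const_add 1).pow 2).inv (pow_pos (pos r) 2).ne')
      convert! d using 1
      have := (pos r).ne'
      simp [hh]
      field_simp
      ring
    · refine squeeze_zero' (g := fun r : ℝ => 3 * r⁻¹) ?_ ?_ ?_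
      · filter_upwards [eventually_ge_atTop 0] with r hr using by positivity
      · filter_upwards [eventually_gt_atTop 0] with r hr
        have := pos r
        rw [← div_eq_mul_inv, ← div_eq_mul_inv, div_div, div_le_div_iff₀ (by positivity) hr]
        nlinarith [sq_nonneg (r ^ 2), sq_nonneg r]
      · simpa using tendsto_inv_atTop_zero.const_mul (3 : ℝ)
  have e : ∫ x : E3, h ‖x‖ = 0 := by
    rw [integral_fun_norm_addHaar, key]
    simp
  exact e

end GroundState

section SmoothCase

open Set Filter Topology

lemma hasLineDerivAt_norm_pow_four {f : E3 → ℂ} (hf : ContDiff ℝ 1 f) (i : Fin 3) (x : E3) :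
    HasLineDerivAt ℝ (fun y => ‖f y‖ ^ 4) (4 * ‖f x‖ ^ 2 * inner ℝ (f x) (pdC i f x)) x
      (e3 i) := by
  have h1 := (((hf.differentiable one_ne_zero) x).hasFDerivAt.norm_sq.pow 2).hasLineDerivAt (e3 i)
  convert! h1 using 1
  · funext y
    simp only [← pow_mul]
  · simp [pdC]
    ring

lemma continuous_pdC {f : E3 → ℂ} (hf : ContDiff ℝ 1 f) (i : Fin 3) : Continuous (pdC i f) :=
  (hf.continuous_fderiv one_ne_zero).clm_apply continuous_const

lemma hasCompactSupport_pdC {f : E3 → ℂ} (hc : HasCompactSupport f) (i : Fin 3) :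
    HasCompactSupport (pdC i f) :=
  hc.fderiv_apply (𝕜 := ℝ) (e3 i)

/-- Integration by parts in a coordinate direction against `|f|⁴`. -/
lemma integral_norm_pow_four_mul {f : E3 → ℂ} (hf : ContDiff ℝ 1 f) (hc : HasCompactSupport f)
    {i : Fin 3} {t d : E3 → ℝ} (ht : Continuous t) (hd : Continuous d)
    (h : ∀ x, HasLineDerivAt ℝ t (d x) x (e3 i)) :
    ∫ x, ‖f x‖ ^ 4 * d x = -∫ x, 4 * ‖f x‖ ^ 2 * inner ℝ (f x) (pdC i f x) * t x := by
  have hfc := hf.continuous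
  have hpc := continuous_pdC hf i
  have key : ∀ {g : E3 → ℝ}, Continuous g → (∀ x, f x = 0 → g x = 0) → Integrable g := by
    intro g hg h0
    refine hg.integrable_of_hasCompactSupport (hc.mono fun x hx hx0 => hx (h0 x hx0))
  exact integral_bilinear_hasLineDerivAt_right_eq_neg_left_of_integrable
    (B := ContinuousLinearMap.mul ℝ ℝ) (f := fun x => ‖f x‖ ^ 4)
    (f' := fun x => 4 * ‖f x‖ ^ 2 * inner ℝ (f x) (pdC i f x)) (g := t) (g' := d) (v := e3 i)
    (key (by simp; fun_prop) (by intro x hx; simp [hx]))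
    (key (by simp; fun_prop) (by intro x hx; simp [hx]))
    (key (by simp; fun_prop) (by intro x hx; simp [hx]))
    (fun x _ => hasLineDerivAt_norm_pow_four hf i x) (fun x _ => h x)

lemma integral_norm_pow_four_mul_le {f : E3 → ℂ} (hf : ContDiff ℝ 1 f) (hc : HasCompactSupport f)
    {i : Fin 3} {t d : E3 → ℝ} (ht : Continuous t) (hd : Continuous d)
    (h : ∀ x, HasLineDerivAt ℝ t (d x) x (e3 i)) :
    ∫ x, ‖f x‖ ^ 4 * d x ≤
      ∫ x, (6 * ‖pdC i f x‖ ^ 2 + 2 / 3 * (‖f x‖ ^ 6 * t x ^ 2)) := by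
  have hfc := hf.continuous
  have hpc := continuous_pdC hf i
  rw [integral_norm_pow_four_mul hf hc ht hd h, ← integral_neg]
  refine integral_mono ?_ ?_ fun x => ?_
  · refine Continuous.integrable_of_hasCompactSupport (by fun_prop)
      (hc.mono fun x hx hx0 => hx (by simp [hx0]))
  · refine Integrable.add ?_ ?_
    · exact Continuous.integrable_of_hasCompactSupport (by fun_prop)
        ((hasCompactSupport_pdC hc i).mono fun x hx hx0 => hx (by simp [hx0]))
    · exact Continuous.integrable_of_hasCompactSupport (by fun_prop)
        (hc.mono fun x hx hx0 => hx (by simp [hx0]))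
  · have h1 : |inner ℝ (f x) (pdC i f x)| ≤ ‖f x‖ * ‖pdC i f x‖ := abs_real_inner_le_norm _ _
    have h2 : -(4 * ‖f x‖ ^ 2 * inner ℝ (f x) (pdC i f x) * t x) ≤
        4 * ‖f x‖ ^ 2 * (‖f x‖ * ‖pdC i f x‖) * |t x| := by
      refine (neg_le_abs _).trans ?_
      rw [abs_mul, abs_mul, abs_of_nonneg (by positivity : 0 ≤ 4 * ‖f x‖ ^ 2)]
      gcongr
    refine h2.trans ?_
    have h3 := sq_nonneg (3 * ‖pdC i f x‖ - ‖f x‖ ^ 3 * |t x|)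
    rw [← sq_abs (t x)]
    nlinarith [h3]

lemma integrable_mul_comp_of_lintegral_eq {F G φ : E3 → ℝ} {T : E3 → E3} {r : ℝ}
    (hF : Continuous F) (hT : Continuous T) (hφ : Continuous φ) (hG : Continuous G)
    (hr : 0 ≤ r) (hF0 : ∀ x, 0 ≤ F x) (hG0 : ∀ x, 0 ≤ G x) (hφ0 : ∀ x, 0 ≤ φ x)
    (hint : Integrable fun x => G x * φ x)
    (h : ∫⁻ x, ENNReal.ofReal (F x * φ (T x)) = ∫⁻ x, ENNReal.ofReal (r * (G x * φ x))) :
    (Integrable fun x => F x * φ (T x)) ∧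
      ∫ x, F x * φ (T x) = r * ∫ x, G x * φ x := by
  have n1 : ∀ x, 0 ≤ F x * φ (T x) := fun x => mul_nonneg (hF0 x) (hφ0 _)
  have n2 : ∀ x, 0 ≤ r * (G x * φ x) := fun x => mul_nonneg hr (mul_nonneg (hG0 x) (hφ0 _))
  have c1 : Continuous fun x => F x * φ (T x) := by fun_prop
  have c2 : Continuous fun x => r * (G x * φ x) := by fun_prop
  refine ⟨⟨c1.aestronglyMeasurable, ?_⟩, ?_⟩
  · rw [hasFiniteIntegral_iff_ofReal (Eventually.of_forall n1), h,
      ← hasFiniteIntegral_iff_ofReal (Eventually.of_forall n2)]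
    exact (hint.const_mul r).2
  · rw [← integral_const_mul,
      integral_eq_lintegral_of_nonneg_ae (Eventually.of_forall n1) c1.aestronglyMeasurable,
      integral_eq_lintegral_of_nonneg_ae (Eventually.of_forall n2) c2.aestronglyMeasurable, h]

lemma three_mul_le_add_of_pow_three_le_mul {a b c s : ℝ} (ha : 0 < a) (hb : 0 < b) (hc : 0 < c)
    (h : s ^ 3 ≤ a * b * c) : 3 * s ≤ a + b + c := by
  by_contra! hlt
  have h1 : 27 * (a * b * c) ≤ (a + b + c) ^ 3 := by
    nlinarith [mul_nonneg ha.le (sq_nonneg (b - c)), mul_nonneg hb.le (sq_nonneg (a - c)),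
      mul_nonneg hc.le (sq_nonneg (a - b)),
      mul_nonneg (add_pos (add_pos ha hb) hc).le (sq_nonneg (b - c)),
      mul_nonneg (add_pos (add_pos ha hb) hc).le (sq_nonneg (a - c)),
      mul_nonneg (add_pos (add_pos ha hb) hc).le (sq_nonneg (a - b))]
  have h2 : (a + b + c) ^ 3 < (3 * s) ^ 3 := by gcongr
  nlinarith

end SmoothCase

section NormalizedInequality

open Set Filter Topology

lemma exists_cauchy_bound {g : E3 → ℝ} (hg : Continuous g) (hc : HasCompactSupport g) :
    ∃ C, 0 ≤ C ∧ ∀ x, g x ≤ C * (1 + x 0 ^ 2)⁻¹ * (1 + x 1 ^ 2)⁻¹ * (1 + x 2 ^ 2)⁻¹ := by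
  obtain ⟨C, hC⟩ := Continuous.bounded_above_of_compact_support
    (f := fun x : E3 => g x * ((1 + x 0 ^ 2) * (1 + x 1 ^ 2) * (1 + x 2 ^ 2)))
    (by fun_prop) (hc.mono fun x hx hx0 => hx (by simp [hx0]))
  refine ⟨C, (norm_nonneg _).trans (hC 0), fun x => ?_⟩
  have h := (le_abs_self _).trans (hC x)
  rw [mul_assoc C, mul_assoc C, ← mul_inv, ← mul_inv, ← div_eq_mul_inv,
    le_div_iff₀ (by positivity)]
  exact h

lemma integral_add_add {X : Type*} [MeasurableSpace X] {μ : Measure X} {a b c : X → ℝ}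
    (ha : Integrable a μ) (hb : Integrable b μ) (hc : Integrable c μ) :
    ∫ x, (a x + b x + c x) ∂μ = (∫ x, a x ∂μ) + (∫ x, b x ∂μ) + ∫ x, c x ∂μ := by
  have h : Integrable (fun x => a x + b x) μ := ha.add hb
  rw [integral_add h hc, integral_add ha hb]

/-- The inequality obtained by transporting `|f|⁶`, regularised by `ε W⁶`, onto `W⁶` by the Knothe
map, with the weight `W⁻²` truncated at height `M`. -/
lemma knothe_transport_inequality {f : E3 → ℂ} (hf : ContDiff ℝ 1 f) (hc : HasCompactSupport f)
    (hm : ∫ x, ‖f x‖ ^ 6 = ∫ x, (talentiBase x ^ 3)⁻¹) {ε M : ℝ} (hε : 0 < ε) (hM : 0 ≤ M) :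
    3 * ((1 + ε) * (∫ x, (talentiBase x ^ 3)⁻¹ * min (talentiBase x) M) -
      ε * (M * ∫ x, (talentiBase x ^ 3)⁻¹)) ≤
    (1 + ε) * (6 * (∫ x, gradSqC f x) +
      2 / 3 * ((1 + ε) * ∫ x : E3, ‖x‖ ^ 2 * (talentiBase x ^ 3)⁻¹)) := by
  have hfc := hf.continuous
  have hHc := continuous_talentiBase
  have hGc := continuous_inv_talentiBase_pow 3
  have hG0 : ∀ x, 0 < (talentiBase x ^ 3)⁻¹ := fun x => inv_pos.2 (pow_pos (talentiBase_pos x) 3)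
  have hGi := integrable_inv_talentiBase_cube
  set G : E3 → ℝ := fun x => (talentiBase x ^ 3)⁻¹ with hG
  set F : E3 → ℝ := fun x => ‖f x‖ ^ 6 + ε * G x with hF
  have hFc : Continuous F := by fun_prop
  have hF0 : ∀ x, 0 < F x := fun x => add_pos_of_nonneg_of_pos (by positivity) (mul_pos hε (hG0 x))
  have hGle : ∀ x, G x ≤ 27 * (1 + x 0 ^ 2)⁻¹ * (1 + x 1 ^ 2)⁻¹ * (1 + x 2 ^ 2)⁻¹ :=
    inv_talentiBase_cube_le
  have hfi : ∀ {g : E3 → ℝ}, Continuous g → Integrable fun x => ‖f x‖ ^ 6 * g x := by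
    intro g hg
    exact Continuous.integrable_of_hasCompactSupport (by fun_prop)
      (hc.mono fun x hx hx0 => hx (by simp [hx0]))
  have hf6 : Integrable fun x => ‖f x‖ ^ 6 := by simpa using hfi (continuous_const (y := (1 : ℝ)))
  obtain ⟨C, hC, hCf⟩ := exists_cauchy_bound (g := fun x => ‖f x‖ ^ 6) (by fun_prop)
    (hc.mono fun x hx hx0 => hx (by simp [hx0]))
  obtain ⟨T, D, r, hr, hT, hD, hD0, hder, hjac, hch⟩ := exists_knothe_E3 (F := F) (G := G)
    (C := C + ε * 27) (C' := 27) (by positivity) (by norm_num) hFc hF0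
    (fun x => by
      have h1 := hCf x
      have h2 := mul_le_mul_of_nonneg_left (hGle x) hε.le
      refine (add_le_add h1 h2).trans_eq ?_
      ring) hGc hG0 hGle
  have push : ∀ {φ : E3 → ℝ}, Continuous φ → (∀ x, 0 ≤ φ x) →
      (Integrable fun x => G x * φ x) → (Integrable fun x => F x * φ (T x)) ∧
        ∫ x, F x * φ (T x) = r * ∫ x, G x * φ x := by
    intro φ hφ hφ0 hint
    refine integrable_mul_comp_of_lintegral_eq hFc hT hφ hGc hr.le (fun x => (hF0 x).le)
      (fun x => (hG0 x).le) hφ0 hint ?_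
    rw [← hch (fun x => ENNReal.ofReal (r * (G x * φ x))) (by
      have : Continuous fun x => r * (G x * φ x) := by fun_prop
      exact this.measurable.ennreal_ofReal)]
    refine lintegral_congr fun x => ?_
    rw [← ENNReal.ofReal_mul (by
      have h0 := hD0 0 x
      have h1 := hD0 1 x
      have h2 := hD0 2 x
      positivity), ← hjac x]
    congr 1
    ring
  have hA : 0 < ∫ x, G x :=
    (integral_pos_iff_support_of_nonneg (fun x => (hG0 x).le) hGi).2 (by
      have : Function.support G = univ := eq_univ_of_forall fun x => (hG0 x).ne'
      rw [this]
      simp)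
  have hr1 : r = 1 + ε := by
    have h := (push continuous_const (fun _ => zero_le_one' ℝ) (by simpa using hGi)).2
    simp only [mul_one] at h
    have h2 : ∫ x, F x = (∫ x, ‖f x‖ ^ 6) + ε * ∫ x, G x := by
      rw [hF, integral_add hf6 (hGi.const_mul ε), integral_const_mul]
    rw [h2, hm] at h
    have h3 : (r - (1 + ε)) * ∫ x, G x = 0 := by linarith
    linarith [(mul_eq_zero.1 h3).resolve_right hA.ne']
  set mn : E3 → ℝ := fun x => min (talentiBase x) M with hmn
  have hmnc : Continuous mn := by fun_prop
  have hmn0 : ∀ x, 0 ≤ mn x := fun x => le_min (talentiBase_pos x).le hM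
  have hmnM : ∀ x, mn x ≤ M := fun x => min_le_right _ _
  have hGmn : ∀ {S : E3 → E3}, Continuous S → Integrable fun x => G x * mn (S x) := by
    intro S hS
    refine (hGi.mul_const M).mono' (by fun_prop) (Eventually.of_forall fun x => ?_)
    rw [Real.norm_of_nonneg (mul_nonneg (hG0 x).le (hmn0 _))]
    exact mul_le_mul_of_nonneg_left (hmnM _) (hG0 x).le
  -- transport of the truncated weight
  have lower : r * (∫ x, G x * mn x) - ε * (M * ∫ x, G x) ≤ ∫ x, ‖f x‖ ^ 6 * mn (T x) := by
    have h1 := (push hmnc hmn0 (hGmn continuous_id)).2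
    have h2 : ∫ x, F x * mn (T x) =
        (∫ x, ‖f x‖ ^ 6 * mn (T x)) + ε * ∫ x, G x * mn (T x) := by
      rw [← integral_const_mul, ← integral_add (hfi (by fun_prop)) ((hGmn hT).const_mul ε)]
      refine integral_congr_ae (Eventually.of_forall fun x => ?_)
      simp only [hF]
      ring
    have h3 : ∫ x, G x * mn (T x) ≤ M * ∫ x, G x := by
      rw [← integral_const_mul]
      refine integral_mono (hGmn hT) (hGi.const_mul M) fun x => ?_
      rw [mul_comm M]
      exact mul_le_mul_of_nonneg_left (hmnM _) (hG0 x).le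
    have h4 := mul_le_mul_of_nonneg_left h3 hε.le
    linarith
  have upper : ∫ x, ‖f x‖ ^ 6 * ‖T x‖ ^ 2 ≤ r * ∫ x : E3, ‖x‖ ^ 2 * G x := by
    have hi : Integrable fun x : E3 => G x * ‖x‖ ^ 2 := by
      simpa only [mul_comm] using integrable_norm_sq_mul_inv_talentiBase_cube
    have h1 := push (φ := fun x => ‖x‖ ^ 2) (by fun_prop) (fun x => by positivity) hi
    simp only [mul_comm (‖_‖ ^ 2) (G _)]
    rw [← h1.2]
    refine integral_mono (hfi (by fun_prop)) h1.1 fun x => ?_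
    refine mul_le_mul_of_nonneg_right ?_ (by positivity)
    exact le_add_of_nonneg_right (mul_pos hε (hG0 x)).le
  have trace : ∀ x, 3 * (‖f x‖ ^ 6 * mn (T x)) ≤
      r * (‖f x‖ ^ 4 * D 0 x + ‖f x‖ ^ 4 * D 1 x + ‖f x‖ ^ 4 * D 2 x) := by
    intro x
    have hH := talentiBase_pos (T x)
    have h1 : 3 * (‖f x‖ ^ 2 * talentiBase (T x) / r) ≤ D 0 x + D 1 x + D 2 x := by
      refine three_mul_le_add_of_pow_three_le_mul (hD0 0 x) (hD0 1 x) (hD0 2 x) ?_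
      have h2 : ‖f x‖ ^ 6 ≤ D 0 x * D 1 x * D 2 x * (r * (talentiBase (T x) ^ 3)⁻¹) := by
        refine le_trans ?_ (hjac x).ge
        exact le_add_of_nonneg_right (mul_pos hε (hG0 x)).le
      have h3 : ‖f x‖ ^ 6 * talentiBase (T x) ^ 3 / r ≤ D 0 x * D 1 x * D 2 x := by
        rw [div_le_iff₀ hr]
        calc _ ≤ D 0 x * D 1 x * D 2 x * (r * (talentiBase (T x) ^ 3)⁻¹) *
              talentiBase (T x) ^ 3 := by gcongr
          _ = _ := by field_simp
      refine le_trans ?_ h3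
      rw [div_pow, mul_pow, ← pow_mul]
      gcongr
      exact le_self_pow₀ (by linarith) (by norm_num)
    have h4 : 3 * (‖f x‖ ^ 2 * mn (T x) / r) ≤ 3 * (‖f x‖ ^ 2 * talentiBase (T x) / r) := by
      gcongr
      exact min_le_left _ _
    have h5 := mul_le_mul_of_nonneg_left (h4.trans h1) (by positivity : 0 ≤ r * ‖f x‖ ^ 4)
    calc _ = r * ‖f x‖ ^ 4 * (3 * (‖f x‖ ^ 2 * mn (T x) / r)) := by field_simp
      _ ≤ _ := h5
      _ = _ := by ring
  have hf4 : ∀ i, Integrable fun x => ‖f x‖ ^ 4 * D i x := by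
    intro i
    have := hD i
    exact Continuous.integrable_of_hasCompactSupport (by fun_prop)
      (hc.mono fun x hx hx0 => hx (by simp [hx0]))
  have hTi : ∀ i, Continuous fun x => T x i := fun i => by fun_prop
  have hpd : ∀ i, Integrable fun x => 6 * ‖pdC i f x‖ ^ 2 := by
    intro i
    have := continuous_pdC hf i
    exact Continuous.integrable_of_hasCompactSupport (by fun_prop)
      ((hasCompactSupport_pdC hc i).mono fun x hx hx0 => hx (by simp [hx0]))
  have parts := fun i => integral_norm_pow_four_mul_le hf hc (hTi i) (hD i) (hder i)
  have hrhs : ∀ i, Integrable fun x =>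
      6 * ‖pdC i f x‖ ^ 2 + 2 / 3 * (‖f x‖ ^ 6 * T x i ^ 2) := fun i =>
    (hpd i).add ((hfi ((hTi i).pow 2)).const_mul _)
  have sum_parts : (∫ x, 6 * ‖pdC 0 f x‖ ^ 2 + 2 / 3 * (‖f x‖ ^ 6 * T x 0 ^ 2)) +
      (∫ x, 6 * ‖pdC 1 f x‖ ^ 2 + 2 / 3 * (‖f x‖ ^ 6 * T x 1 ^ 2)) +
      (∫ x, 6 * ‖pdC 2 f x‖ ^ 2 + 2 / 3 * (‖f x‖ ^ 6 * T x 2 ^ 2)) =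
      6 * (∫ x, gradSqC f x) + 2 / 3 * ∫ x, ‖f x‖ ^ 6 * ‖T x‖ ^ 2 := by
    have hgi : Integrable (gradSqC f) :=
      integrable_finsetSum _ fun i _ => by simpa using (hpd i).const_mul (6 : ℝ)⁻¹
    rw [← integral_add_add (hrhs 0) (hrhs 1) (hrhs 2),
      ← integral_const_mul, ← integral_const_mul, ← integral_add (hgi.const_mul 6)
        ((hfi (by fun_prop)).const_mul _)]
    refine integral_congr_ae (Eventually.of_forall fun x => ?_)
    simp only [gradSqC, Fin.sum_univ_three, E3_norm_sq]
    ring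
  have htr : 3 * (∫ x, ‖f x‖ ^ 6 * mn (T x)) ≤ r * ((∫ x, ‖f x‖ ^ 4 * D 0 x) +
      (∫ x, ‖f x‖ ^ 4 * D 1 x) + ∫ x, ‖f x‖ ^ 4 * D 2 x) := by
    rw [← integral_add_add (hf4 0) (hf4 1) (hf4 2),
      ← integral_const_mul, ← integral_const_mul]
    exact integral_mono ((hfi (by fun_prop)).const_mul 3)
      ((((hf4 0).add (hf4 1)).add (hf4 2)).const_mul r) trace
  rw [← hr1]
  have hsum := add_le_add (add_le_add (parts 0) (parts 1)) (parts 2)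
  rw [sum_parts] at hsum
  calc _ ≤ 3 * ∫ x, ‖f x‖ ^ 6 * mn (T x) := by linarith
    _ ≤ _ := htr
    _ ≤ r * (6 * (∫ x, gradSqC f x) + 2 / 3 * ∫ x, ‖f x‖ ^ 6 * ‖T x‖ ^ 2) := by gcongr
    _ ≤ _ := by gcongr

end NormalizedInequality

section CompactSupport

open Set Filter Topology

lemma integral_gradSqR_W_le_of_integral_eq {f : E3 → ℂ} (hf : ContDiff ℝ 1 f)
    (hc : HasCompactSupport f) (hm : ∫ x, ‖f x‖ ^ 6 = ∫ x, (talentiBase x ^ 3)⁻¹) :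
    ∫ x, gradSqR W x ≤ ∫ x, gradSqC f x := by
  have hM : ∀ M : ℝ, 0 ≤ M → 3 * (∫ x, (talentiBase x ^ 3)⁻¹ * min (talentiBase x) M) ≤
      6 * (∫ x, gradSqC f x) + 2 / 3 * ∫ x : E3, ‖x‖ ^ 2 * (talentiBase x ^ 3)⁻¹ := by
    intro M hM
    have hle := (eventually_mem_nhdsWithin (a := (0 : ℝ)) (s := Ioi 0)).mono
      fun ε hε => knothe_transport_inequality hf hc hm (ε := ε) hε hM
    refine le_of_tendsto_of_tendsto (b := 𝓝[>] (0 : ℝ)) ?_ ?_ hle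
    · refine (Continuous.tendsto' ?_ 0 _ ?_).mono_left nhdsWithin_le_nhds
      · fun_prop
      · ring
    · refine (Continuous.tendsto' ?_ 0 _ ?_).mono_left nhdsWithin_le_nhds
      · fun_prop
      · ring
  have e : ∀ x, (talentiBase x ^ 3)⁻¹ * talentiBase x = (talentiBase x ^ 2)⁻¹ := by
    intro x
    have := (talentiBase_pos x).ne'
    field_simp
  have lim : Tendsto (fun n : ℕ => ∫ x, (talentiBase x ^ 3)⁻¹ * min (talentiBase x) n) atTop
      (𝓝 (∫ x, (talentiBase x ^ 2)⁻¹)) := by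
    have hHc := continuous_talentiBase
    have hGc := continuous_inv_talentiBase_pow 3
    refine tendsto_integral_of_dominated_convergence (fun x => (talentiBase x ^ 2)⁻¹) (fun n => ?_)
      integrable_inv_talentiBase_sq (fun n => Eventually.of_forall fun x => ?_)
      (Eventually.of_forall fun x => ?_)
    · exact Continuous.aestronglyMeasurable (by fun_prop)
    · have h0 := talentiBase_pos x
      rw [Real.norm_of_nonneg (by positivity), ← e]
      gcongr
      exact min_le_left _ _
    · refine tendsto_const_nhds.congr' ?_
      filter_upwards [tendsto_natCast_atTop_atTop.eventually_ge_atTop (talentiBase x)] with n hn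
      rw [min_eq_left hn, e]
  have h := le_of_tendsto' (lim.const_mul 3) fun n : ℕ => hM n n.cast_nonneg
  rw [integral_inv_talentiBase_sq] at h
  simp only [gradSqR_W]
  rw [integral_div]
  linarith

lemma integral_inv_talentiBase_cube_pos : 0 < ∫ x, (talentiBase x ^ 3)⁻¹ :=
  (integral_pos_iff_support_of_nonneg
    (fun x => (inv_pos.2 (pow_pos (talentiBase_pos x) 3)).le) integrable_inv_talentiBase_cube).2 (by
      have : Function.support (fun x => (talentiBase x ^ 3)⁻¹) = univ :=
        eq_univ_of_forall fun x => (inv_pos.2 (pow_pos (talentiBase_pos x) 3)).ne'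
      rw [this]
      simp)

lemma gradSqC_nonneg (f : E3 → ℂ) (x : E3) : 0 ≤ gradSqC f x :=
  Finset.sum_nonneg fun _ _ => sq_nonneg _

lemma integral_gradSqR_W_pos : 0 < ∫ x, gradSqR W x := by
  have h : 0 < ∫ x, (talentiBase x ^ 2)⁻¹ :=
    integral_inv_talentiBase_cube_pos.trans_le (integral_mono integrable_inv_talentiBase_cube
      integrable_inv_talentiBase_sq fun x => inv_anti₀ (pow_pos (talentiBase_pos x) 2)
        (pow_le_pow_right₀ (one_le_talentiBase x) (by norm_num)))
  rw [integral_inv_talentiBase_sq] at h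
  simp only [gradSqR_W]
  rw [integral_div]
  linarith

lemma gradSqC_const_smul {f : E3 → ℂ} (hf : ContDiff ℝ 1 f) (c : ℝ) (x : E3) :
    gradSqC (c • f) x = c ^ 2 * gradSqC f x := by
  simp only [gradSqC, pdC, Finset.mul_sum]
  refine Finset.sum_congr rfl fun i _ => ?_
  rw [fderiv_const_smul ((hf.differentiable one_ne_zero) x)]
  simp [mul_pow]

/-- The sharp Sobolev inequality, squared, for compactly supported functions. -/
lemma sobolev_of_hasCompactSupport {f : E3 → ℂ} (hf : ContDiff ℝ 1 f)
    (hc : HasCompactSupport f) :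
    (∫ x, gradSqR W x) * (∫ x, ‖f x‖ ^ 6) ^ ((1 : ℝ) / 3) ≤
      (∫ x, W x ^ 6) ^ ((1 : ℝ) / 3) * ∫ x, gradSqC f x := by
  simp only [W_pow_six]
  have hA := integral_inv_talentiBase_cube_pos
  set A := ∫ x, (talentiBase x ^ 3)⁻¹ with hAdef
  set N := ∫ x, ‖f x‖ ^ 6 with hN
  have hN0 : 0 ≤ N := integral_nonneg fun x => by positivity
  have hD0 : 0 ≤ ∫ x, gradSqC f x := integral_nonneg (gradSqC_nonneg f)
  rcases hN0.eq_or_lt with h0 | h0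
  · rw [← h0, Real.zero_rpow (by norm_num), mul_zero]
    positivity
  set c : ℝ := (A / N) ^ ((1 : ℝ) / 6) with hcdef
  have hc0 : 0 ≤ c := by positivity
  have hc6 : c ^ 6 = A / N := by
    rw [hcdef, ← Real.rpow_natCast, ← Real.rpow_mul (by positivity)]
    norm_num
  have hc2 : c ^ 2 = A ^ ((1 : ℝ) / 3) / N ^ ((1 : ℝ) / 3) := by
    rw [hcdef, ← Real.rpow_natCast, ← Real.rpow_mul (by positivity),
      ← Real.div_rpow hA.le h0.le]
    norm_num
  have h := integral_gradSqR_W_le_of_integral_eq (f := c • f) (hf.const_smul c)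
    (hc.mono fun x hx hx0 => hx (by simp [hx0])) (by
    simp only [Pi.smul_apply, norm_smul, Real.norm_of_nonneg hc0, mul_pow, integral_const_mul]
    rw [hc6, ← hN, div_mul_cancel₀ _ h0.ne'])
  simp only [gradSqC_const_smul hf, integral_const_mul] at h
  rw [hc2, div_mul_eq_mul_div, le_div_iff₀ (by positivity)] at h
  exact h

end CompactSupport

section Cutoff

open Set Filter Topology

lemma add_sq_le_of_pos {a b δ : ℝ} (hδ : 0 < δ) :
    (a + b) ^ 2 ≤ (1 + δ) * a ^ 2 + (1 + δ⁻¹) * b ^ 2 := by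
  have h : 0 ≤ δ⁻¹ * (δ * a - b) ^ 2 := by positivity
  have e : δ⁻¹ * (δ * a - b) ^ 2 = δ * a ^ 2 - 2 * a * b + δ⁻¹ * b ^ 2 := by
    field_simp
    ring
  linarith

lemma inv_sq_mul_le {a R s : ℝ} (ha : 0 ≤ a) (hR : 0 < R) (hs : 0 < s) :
    (R ^ 2)⁻¹ * a ≤ s ^ 2 * a ^ 3 + (R ^ 3)⁻¹ * s⁻¹ := by
  rcases le_total R⁻¹ (s * a) with h | h
  · have h2 : (R⁻¹) ^ 2 ≤ (s * a) ^ 2 := by gcongr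
    calc (R ^ 2)⁻¹ * a = R⁻¹ ^ 2 * a := by rw [inv_pow]
      _ ≤ (s * a) ^ 2 * a := by gcongr
      _ = s ^ 2 * a ^ 3 := by ring
      _ ≤ _ := le_add_of_nonneg_right (by positivity)
  · have h2 : a ≤ R⁻¹ * s⁻¹ := by
      rw [← div_eq_mul_inv, le_div_iff₀ hs, mul_comm]
      exact h
    calc (R ^ 2)⁻¹ * a ≤ (R ^ 2)⁻¹ * (R⁻¹ * s⁻¹) := by gcongr
      _ = (R ^ 3)⁻¹ * s⁻¹ := by field_simp
      _ ≤ _ := le_add_of_nonneg_left (by positivity)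

lemma exists_cutoff : ∃ (χ : E3 → ℝ) (K : ℝ), ContDiff ℝ 1 χ ∧ (∀ x, 0 ≤ χ x) ∧
    (∀ x, χ x ≤ 1) ∧ (∀ x, ‖x‖ ≤ 1 → χ x = 1) ∧ (∀ x, 2 ≤ ‖x‖ → χ x = 0) ∧
    (∀ x, ‖fderiv ℝ χ x‖ ≤ K) ∧ (∀ x, ‖x‖ < 1 → fderiv ℝ χ x = 0) ∧
    ∀ x, 2 < ‖x‖ → fderiv ℝ χ x = 0 := by
  let φ : ContDiffBump (0 : E3) := ⟨1, 2, one_pos, one_lt_two⟩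
  have h1 : ∀ x, ‖x‖ ≤ 1 → φ x = 1 := fun x hx => φ.one_of_mem_closedBall (by simpa using hx)
  have h2 : ∀ x, 2 ≤ ‖x‖ → φ x = 0 := fun x hx => φ.zero_of_le_dist (by simpa using hx)
  have hφ : ContDiff ℝ 1 φ := φ.contDiff
  obtain ⟨K, hK⟩ := (hφ.continuous_fderiv one_ne_zero).bounded_above_of_compact_support
    (φ.hasCompactSupport.fderiv (𝕜 := ℝ))
  refine ⟨φ, K, hφ, fun x => φ.nonneg, fun x => φ.le_one, h1, h2, hK, fun x hx => ?_,
    fun x hx => ?_⟩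
  · have : (φ : E3 → ℝ) =ᶠ[𝓝 x] fun _ => 1 := by
      filter_upwards [(isOpen_lt continuous_norm continuous_const).mem_nhds hx] with y hy
        using h1 y (le_of_lt hy)
    rw [this.fderiv_eq]
    simp
  · have : (φ : E3 → ℝ) =ᶠ[𝓝 x] fun _ => 0 := by
      filter_upwards [(isOpen_lt continuous_const continuous_norm).mem_nhds hx] with y hy
        using h2 y (le_of_lt hy)
    rw [this.fderiv_eq]
    simp

lemma gradSqC_cutoff_le {χ : E3 → ℝ} {K : ℝ} (hχ : ContDiff ℝ 1 χ) (h0 : ∀ x, 0 ≤ χ x)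
    (h1 : ∀ x, χ x ≤ 1) (hK : ∀ x, ‖fderiv ℝ χ x‖ ≤ K)
    (hin : ∀ x, ‖x‖ < 1 → fderiv ℝ χ x = 0) (hout : ∀ x, 2 < ‖x‖ → fderiv ℝ χ x = 0)
    {f : E3 → ℂ} (hf : ContDiff ℝ 1 f) {R δ : ℝ} (hR : 0 < R) (hδ : 0 < δ) (x : E3) :
    gradSqC (fun y => χ (R⁻¹ • y) • f y) x ≤ (1 + δ) * gradSqC f x +
      3 * (1 + δ⁻¹) * K ^ 2 *
        {y : E3 | R ≤ ‖y‖ ∧ ‖y‖ ≤ 2 * R}.indicator (fun y => (R ^ 2)⁻¹ * ‖f y‖ ^ 2) x := by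
  have hsc : HasFDerivAt (fun y : E3 => χ (R⁻¹ • y))
      ((fderiv ℝ χ (R⁻¹ • x)).comp (R⁻¹ • ContinuousLinearMap.id ℝ E3)) x :=
    ((hχ.differentiable one_ne_zero) _).hasFDerivAt.comp x
      ((hasFDerivAt_id x).const_smul R⁻¹)
  have hg : HasFDerivAt (fun y => χ (R⁻¹ • y) • f y) _ x :=
    hsc.smul ((hf.differentiable one_ne_zero) x).hasFDerivAt
  have hpd : ∀ i, pdC i (fun y => χ (R⁻¹ • y) • f y) x =
      χ (R⁻¹ • x) • pdC i f x + (R⁻¹ * fderiv ℝ χ (R⁻¹ • x) (e3 i)) • f x := by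
    intro i
    rw [pdC, hg.fderiv]
    simp [pdC]
  have hn : ‖R⁻¹ • x‖ = ‖x‖ / R := by
    rw [norm_smul, Real.norm_of_nonneg (by positivity), inv_mul_eq_div]
  have herr : ∀ i, ‖(R⁻¹ * fderiv ℝ χ (R⁻¹ • x) (e3 i)) • f x‖ ^ 2 ≤ K ^ 2 *
      {y : E3 | R ≤ ‖y‖ ∧ ‖y‖ ≤ 2 * R}.indicator (fun y => (R ^ 2)⁻¹ * ‖f y‖ ^ 2) x := by
    intro i
    by_cases hx : x ∈ {y : E3 | R ≤ ‖y‖ ∧ ‖y‖ ≤ 2 * R}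
    · rw [indicator_of_mem hx, norm_smul, mul_pow, norm_mul, mul_pow,
        Real.norm_of_nonneg (by positivity : 0 ≤ R⁻¹), inv_pow]
      have h : ‖fderiv ℝ χ (R⁻¹ • x) (e3 i)‖ ≤ K := by
        refine ((fderiv ℝ χ (R⁻¹ • x)).le_opNorm _).trans ?_
        simpa [e3] using hK _
      calc _ ≤ (R ^ 2)⁻¹ * K ^ 2 * ‖f x‖ ^ 2 := by gcongr
        _ = _ := by ring
    · have hz : fderiv ℝ χ (R⁻¹ • x) = 0 := by
        by_cases hx1 : R ≤ ‖x‖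
        · refine hout _ ?_
          rw [hn, lt_div_iff₀ hR]
          exact not_le.1 fun h => hx ⟨hx1, h⟩
        · refine hin _ ?_
          rw [hn, div_lt_one hR]
          exact not_le.1 hx1
      rw [indicator_of_notMem hx, hz]
      simp
  have hterm : ∀ i, ‖pdC i (fun y => χ (R⁻¹ • y) • f y) x‖ ^ 2 ≤
      (1 + δ) * ‖pdC i f x‖ ^ 2 + (1 + δ⁻¹) * (K ^ 2 *
        {y : E3 | R ≤ ‖y‖ ∧ ‖y‖ ≤ 2 * R}.indicator (fun y => (R ^ 2)⁻¹ * ‖f y‖ ^ 2) x) := by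
    intro i
    rw [hpd]
    have hδ' : 0 ≤ 1 + δ⁻¹ := by positivity
    have hχ1 : ‖χ (R⁻¹ • x) • pdC i f x‖ ≤ ‖pdC i f x‖ := by
      rw [norm_smul, Real.norm_of_nonneg (h0 _)]
      exact mul_le_of_le_one_left (norm_nonneg _) (h1 _)
    calc _ ≤ (‖χ (R⁻¹ • x) • pdC i f x‖ +
          ‖(R⁻¹ * fderiv ℝ χ (R⁻¹ • x) (e3 i)) • f x‖) ^ 2 := by
          gcongr
          exact norm_add_le _ _
      _ ≤ _ := add_sq_le_of_pos hδ
      _ ≤ _ := by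
          gcongr
          exact herr i
  refine (Finset.sum_le_sum fun i _ => hterm i).trans_eq ?_
  simp only [gradSqC, Fin.sum_univ_three]
  ring

lemma integral_annulus_le {f : E3 → ℂ} (hf : Continuous f)
    (hf6 : Integrable fun x => ‖f x‖ ^ 6) {R s : ℝ} (hR : 0 < R) (hs : 0 < s) :
    (Integrable ({y : E3 | R ≤ ‖y‖ ∧ ‖y‖ ≤ 2 * R}.indicator fun y => (R ^ 2)⁻¹ * ‖f y‖ ^ 2)) ∧
    ∫ x, {y : E3 | R ≤ ‖y‖ ∧ ‖y‖ ≤ 2 * R}.indicator (fun y => (R ^ 2)⁻¹ * ‖f y‖ ^ 2) x ≤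
      s ^ 2 * (∫ x, {y : E3 | R ≤ ‖y‖}.indicator (fun y => ‖f y‖ ^ 6) x) +
        8 * volume.real (Metric.closedBall (0 : E3) 1) * s⁻¹ := by
  have hm1 : MeasurableSet {y : E3 | R ≤ ‖y‖} := measurableSet_le measurable_const measurable_norm
  have hm2 : MeasurableSet {y : E3 | R ≤ ‖y‖ ∧ ‖y‖ ≤ 2 * R} :=
    hm1.inter (measurableSet_le measurable_norm measurable_const)
  have hb : ∀ x, {y : E3 | R ≤ ‖y‖ ∧ ‖y‖ ≤ 2 * R}.indicator (fun y => (R ^ 2)⁻¹ * ‖f y‖ ^ 2) x ≤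
      s ^ 2 * {y : E3 | R ≤ ‖y‖}.indicator (fun y => ‖f y‖ ^ 6) x +
        (Metric.closedBall (0 : E3) (2 * R)).indicator (fun _ => (R ^ 3)⁻¹ * s⁻¹) x := by
    intro x
    by_cases hx : x ∈ {y : E3 | R ≤ ‖y‖ ∧ ‖y‖ ≤ 2 * R}
    · have hx1 : x ∈ {y : E3 | R ≤ ‖y‖} := hx.1
      have hx2 : x ∈ Metric.closedBall (0 : E3) (2 * R) := by simpa using hx.2
      rw [indicator_of_mem hx, indicator_of_mem hx1, indicator_of_mem hx2]
      have := inv_sq_mul_le (a := ‖f x‖ ^ 2) (by positivity) hR hs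
      rwa [← pow_mul] at this
    · rw [indicator_of_notMem hx]
      refine add_nonneg (mul_nonneg (by positivity) (indicator_nonneg (fun _ _ => by positivity) _))
        (indicator_nonneg (fun _ _ => by positivity) _)
  have hi1 : Integrable fun x => s ^ 2 * {y : E3 | R ≤ ‖y‖}.indicator (fun y => ‖f y‖ ^ 6) x :=
    (hf6.indicator hm1).const_mul _
  have hi2 : Integrable
      ((Metric.closedBall (0 : E3) (2 * R)).indicator fun _ => (R ^ 3)⁻¹ * s⁻¹) :=
    (integrable_indicator_iff measurableSet_closedBall).2
      (integrableOn_const measure_closedBall_lt_top.ne)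
  have hi3 : Integrable
      ({y : E3 | R ≤ ‖y‖ ∧ ‖y‖ ≤ 2 * R}.indicator fun y => (R ^ 2)⁻¹ * ‖f y‖ ^ 2) := by
    refine (hi1.add hi2).mono' ?_ (Eventually.of_forall fun x => ?_)
    · exact (Continuous.aestronglyMeasurable (by fun_prop)).indicator hm2
    · rw [Real.norm_of_nonneg (indicator_nonneg (fun _ _ => by positivity) _)]
      exact hb x
  refine ⟨hi3, (integral_mono hi3 (hi1.add hi2) hb).trans_eq ?_⟩
  rw [integral_add' hi1 hi2, integral_const_mul, integral_indicator measurableSet_closedBall,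
    setIntegral_const, Measure.real, Measure.addHaar_closedBall' _ _ (by positivity),
    ENNReal.toReal_mul, ENNReal.toReal_ofReal (by positivity), Measure.real]
  simp
  field_simp
  norm_num

end Cutoff

section General

open Set Filter Topology

/-- The sharp Sobolev inequality, squared. -/
lemma sobolev_sq {f : E3 → ℂ} (hf : ContDiff ℝ 1 f) (hf6 : Integrable fun x : E3 => ‖f x‖ ^ 6)
    (hgrad : Integrable (gradSqC f)) :
    (∫ x, gradSqR W x) * (∫ x, ‖f x‖ ^ 6) ^ ((1 : ℝ) / 3) ≤
      (∫ x, W x ^ 6) ^ ((1 : ℝ) / 3) * ∫ x, gradSqC f x := by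
  obtain ⟨χ, K, hχ, h0, h1, hχ1, hχ2, hK, hin, hout⟩ := exists_cutoff
  have hfc := hf.continuous
  have hχc := hχ.continuous
  have hW : 0 ≤ (∫ x, W x ^ 6) ^ ((1 : ℝ) / 3) :=
    Real.rpow_nonneg (integral_nonneg fun x => by
      have : 0 ≤ W x ^ (2 * 3) := by rw [pow_mul]; positivity
      exact this) _
  set B := ∫ x, gradSqR W x with hB
  set A := (∫ x, W x ^ 6) ^ ((1 : ℝ) / 3) with hA
  set D := ∫ x, gradSqC f x with hD
  set V := volume.real (Metric.closedBall (0 : E3) 1) with hV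
  set R : ℕ → ℝ := fun n => n + 1 with hRdef
  have hR : ∀ n, 0 < R n := fun n => by positivity
  have hRlim : Tendsto R atTop atTop :=
    tendsto_natCast_atTop_atTop.atTop_add tendsto_const_nhds
  set g : ℕ → E3 → ℂ := fun n x => χ ((R n)⁻¹ • x) • f x with hg
  have bound : ∀ (n : ℕ) (δ s : ℝ), 0 < δ → 0 < s → B * (∫ x, ‖g n x‖ ^ 6) ^ ((1 : ℝ) / 3) ≤
      A * ((1 + δ) * D + 3 * (1 + δ⁻¹) * K ^ 2 *
        (s ^ 2 * (∫ x, {y : E3 | R n ≤ ‖y‖}.indicator (fun y => ‖f y‖ ^ 6) x) +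
          8 * V * s⁻¹)) := by
    intro n δ s hδ hs
    have hgn : ContDiff ℝ 1 (g n) :=
      (hχ.comp (contDiff_const_smul (R n)⁻¹)).smul hf
    have hgc : HasCompactSupport (g n) := by
      refine HasCompactSupport.of_support_subset_isCompact
        (isCompact_closedBall (0 : E3) (2 * R n)) fun x hx => ?_
      by_contra hx'
      refine hx ?_
      have hx2 : 2 ≤ ‖(R n)⁻¹ • x‖ := by
        rw [norm_smul, Real.norm_of_nonneg (inv_nonneg.2 (hR n).le), inv_mul_eq_div,
          le_div_iff₀ (hR n)]
        simpa using (not_le.1 (by simpa using hx')).le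
      simp [hg, hχ2 _ hx2]
    refine (sobolev_of_hasCompactSupport hgn hgc).trans ?_
    obtain ⟨i1, i2⟩ := integral_annulus_le hfc hf6 (hR n) hs
    refine mul_le_mul_of_nonneg_left ?_ hW
    have i3 := (hgrad.const_mul (1 + δ)).add (i1.const_mul (3 * (1 + δ⁻¹) * K ^ 2))
    calc ∫ x, gradSqC (g n) x ≤ _ := integral_mono_of_nonneg
          (Eventually.of_forall (gradSqC_nonneg _)) i3
          (Eventually.of_forall fun x => gradSqC_cutoff_le hχ h0 h1 hK hin hout hf (hR n) hδ x)
      _ = (1 + δ) * D + 3 * (1 + δ⁻¹) * K ^ 2 * _ := by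
          rw [integral_add' (hgrad.const_mul (1 + δ)) (i1.const_mul (3 * (1 + δ⁻¹) * K ^ 2)),
            integral_const_mul, integral_const_mul]
      _ ≤ _ := by gcongr
  have limN : Tendsto (fun n => ∫ x, ‖g n x‖ ^ 6) atTop (𝓝 (∫ x, ‖f x‖ ^ 6)) := by
    refine tendsto_integral_of_dominated_convergence (fun x => ‖f x‖ ^ 6)
      (fun n => Continuous.aestronglyMeasurable (by fun_prop)) hf6
      (fun n => Eventually.of_forall fun x => ?_) (Eventually.of_forall fun x => ?_)
    · rw [norm_pow, norm_norm]
      gcongr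
      rw [norm_smul, Real.norm_of_nonneg (h0 _)]
      exact mul_le_of_le_one_left (norm_nonneg _) (h1 _)
    · refine tendsto_const_nhds.congr' ?_
      filter_upwards [hRlim.eventually_ge_atTop ‖x‖] with n hn
      have : ‖(R n)⁻¹ • x‖ ≤ 1 := by
        rw [norm_smul, Real.norm_of_nonneg (inv_nonneg.2 (hR n).le), inv_mul_eq_div,
          div_le_one (hR n)]
        exact hn
      simp [hg, hχ1 _ this]
  have limT : Tendsto (fun n => ∫ x, {y : E3 | R n ≤ ‖y‖}.indicator (fun y => ‖f y‖ ^ 6) x) atTop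
      (𝓝 0) := by
    rw [← integral_zero E3 ℝ (μ := volume)]
    refine tendsto_integral_of_dominated_convergence (fun x => ‖f x‖ ^ 6)
      (fun n => hf6.aestronglyMeasurable.indicator
        (measurableSet_le measurable_const measurable_norm))
      hf6 (fun n => Eventually.of_forall fun x => ?_) (Eventually.of_forall fun x => ?_)
    · refine (norm_indicator_le_norm_self _ _).trans_eq ?_
      simp
    · refine tendsto_const_nhds.congr' ?_
      filter_upwards [hRlim.eventually_gt_atTop ‖x‖] with n hn
      rw [indicator_of_notMem]
      exact not_le.2 hn
  have bound1 : ∀ δ s : ℝ, 0 < δ → 0 < s → B * (∫ x, ‖f x‖ ^ 6) ^ ((1 : ℝ) / 3) ≤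
      A * ((1 + δ) * D + 3 * (1 + δ⁻¹) * K ^ 2 * (s ^ 2 * 0 + 8 * V * s⁻¹)) := by
    intro δ s hδ hs
    exact le_of_tendsto_of_tendsto' ((limN.rpow_const (Or.inr (by norm_num))).const_mul B)
      (((((limT.const_mul (s ^ 2)).add_const _).const_mul _).const_add _).const_mul A)
      fun n => bound n δ s hδ hs
  have bound2 : ∀ δ : ℝ, 0 < δ → B * (∫ x, ‖f x‖ ^ 6) ^ ((1 : ℝ) / 3) ≤ A * ((1 + δ) * D) := by
    intro δ hδ
    have lim : Tendsto (fun s : ℝ => A * ((1 + δ) * D + 3 * (1 + δ⁻¹) * K ^ 2 *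
        (s ^ 2 * 0 + 8 * V * s⁻¹))) atTop (𝓝 (A * ((1 + δ) * D))) := by
      have := ((((tendsto_inv_atTop_zero (𝕜 := ℝ)).const_mul (8 * V)).const_mul
        (3 * (1 + δ⁻¹) * K ^ 2)).const_add ((1 + δ) * D)).const_mul A
      simpa using this
    refine ge_of_tendsto lim ?_
    filter_upwards [eventually_gt_atTop 0] with s hs using bound1 δ s hδ hs
  have lim : Tendsto (fun δ : ℝ => A * ((1 + δ) * D)) (𝓝[>] 0) (𝓝 (A * D)) :=
    (Continuous.tendsto' (by fun_prop) 0 _ (by ring)).mono_left nhdsWithin_le_nhds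
  refine ge_of_tendsto lim ?_
  filter_upwards [self_mem_nhdsWithin] with δ hδ using bound2 δ hδ

end General

/-- Sharp Sobolev inequality with constant `C_GN = ‖W‖_{L⁶}/‖∇W‖_{L²}`. -/
theorem sharp_sobolev (f : E3 → ℂ) (hf : ContDiff ℝ 1 f)
    (hf6 : Integrable (fun x : E3 => ‖f x‖ ^ 6))
    (hgrad : Integrable (gradSqC f)) :
    (∫ x : E3, ‖f x‖ ^ 6) ^ ((1:ℝ)/6) ≤ CGN * (∫ x : E3, gradSqC f x) ^ ((1:ℝ)/2) := by
  have h := sobolev_sq hf hf6 hgrad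
  have hB := integral_gradSqR_W_pos
  have hA : 0 < ∫ x, W x ^ 6 := by
    simp only [W_pow_six]
    exact integral_inv_talentiBase_cube_pos
  have hN : 0 ≤ ∫ x, ‖f x‖ ^ 6 := integral_nonneg fun x => by positivity
  have hD : 0 ≤ ∫ x, gradSqC f x := integral_nonneg (gradSqC_nonneg f)
  have root : ∀ {a : ℝ}, 0 ≤ a → (a ^ ((1 : ℝ) / 3)) ^ ((1 : ℝ) / 2) = a ^ ((1 : ℝ) / 6) := by
    intro a ha
    rw [← Real.rpow_mul ha]
    norm_num
  have h2 := Real.rpow_le_rpow (by positivity) h (by norm_num : (0 : ℝ) ≤ 1 / 2)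
  rw [Real.mul_rpow hB.le (by positivity), Real.mul_rpow (by positivity) hD, root hN,
    root hA.le] at h2
  rw [CGN, div_mul_eq_mul_div, le_div_iff₀ (by positivity), mul_comm]
  exact h2
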